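/- Let a, b > 0 with a − 2b > 0, η ∈ (0, √(a−b) − √(a/2)), φ_η an admissible cutoff, and k ∈ ℕ. If I_k is non-empty, then sup I_k ∈ I_k. -/

import Mathlib

open Real Set Filter Topology

noncomputable section

/-- The Hamiltonian energy `H(f,g) = ½ f²(1−g²) + (a/4) g⁴ − (b/2) g²`. -/
def Ham (a b f g : ℝ) : ℝ := 1 / 2 * f ^ 2 * (1 - g ^ 2) + a / 4 * g ^ 4 - b / 2 * g ^ 2

/-- The set `𝒜` of admissible points. -/
def Aadm (a b : ℝ) : Set (ℝ × ℝ) :=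
  {p | 2 * p.1 ^ 2 - a * p.2 ^ 2 - (a - 2 * b) ≤ 0 ∧ p.2 ^ 2 ≤ 1}

/-- `φ` is an admissible cutoff function `φ_η`. -/
def IsCutoff (a b η : ℝ) (φ : ℝ → ℝ → ℝ) : Prop :=
  (∀ f g, φ f g ∈ Icc (0 : ℝ) 1) ∧
  ContDiffOn ℝ (⊤ : ℕ∞) (fun p : ℝ × ℝ => φ p.1 p.2)
    (Ioo (-Real.sqrt (a - b)) (Real.sqrt (a - b)) ×ˢ (univ : Set ℝ)) ∧
  (∀ f g, φ f g = φ |f| |g|) ∧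
  (∀ f g, Real.sqrt (a - b) - η / 2 ≤ |f| → φ f g = 0) ∧
  (∀ f g, |f| ≤ Real.sqrt (a - b) - η → φ f g = 1)

/-- `(f, g)` is a `C¹` solution on `s` of the original Cauchy problem
`f' + (2/r) f = g(f² − a g² + b)`, `g' = f(1 − g²)`, `f(0) = 0`, `g(0) = x`. -/
def IsSolOn (a b x : ℝ) (f g : ℝ → ℝ) (s : Set ℝ) : Prop :=
  f 0 = 0 ∧ g 0 = x ∧ ContinuousOn f s ∧ ContinuousOn g s ∧
  ∀ r ∈ s, 0 < r →
    HasDerivAt f (g r * ((f r) ^ 2 - a * (g r) ^ 2 + b) - 2 / r * f r) r ∧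
    HasDerivAt g (f r * (1 - (g r) ^ 2)) r

/-- `(f, g)` is a `C¹` solution on `s` of the regularized Cauchy problem
`f' + (2 φ(f,g)/r) f = g(f² − a g² + b)`, `g' = f(1 − g²)`, `f(0) = 0`, `g(0) = x`. -/
def IsRegSolOn (a b : ℝ) (φ : ℝ → ℝ → ℝ) (x : ℝ) (f g : ℝ → ℝ) (s : Set ℝ) : Prop :=
  f 0 = 0 ∧ g 0 = x ∧ ContinuousOn f s ∧ ContinuousOn g s ∧
  ∀ r ∈ s, 0 < r →
    HasDerivAt f (g r * ((f r) ^ 2 - a * (g r) ^ 2 + b) - 2 * φ (f r) (g r) / r * f r) r ∧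
    HasDerivAt g (f r * (1 - (g r) ^ 2)) r

/-- `(f, g)` is a solution on `s` of the autonomous (Hamiltonian) system
`f' = g(f² − a g² + b)`, `g' = f(1 − g²)` with initial data `(fi, gi)`. -/
def IsAutSolOn (a b fi gi : ℝ) (f g : ℝ → ℝ) (s : Set ℝ) : Prop :=
  f 0 = fi ∧ g 0 = gi ∧ ContinuousOn f s ∧ ContinuousOn g s ∧
  ∀ r ∈ s,
    HasDerivAt f (g r * ((f r) ^ 2 - a * (g r) ^ 2 + b)) r ∧
    HasDerivAt g (f r * (1 - (g r) ^ 2)) r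

/-- `(f, g)` is a solution on `s` of the shifted regularized system
`f' + (2 φ(f,g)/(ρ+r)) f = g(f² − a g² + b)`, `g' = f(1 − g²)` with initial data `(fi, gi)`. -/
def IsShiftSolOn (a b : ℝ) (φ : ℝ → ℝ → ℝ) (ρ fi gi : ℝ) (f g : ℝ → ℝ) (s : Set ℝ) : Prop :=
  f 0 = fi ∧ g 0 = gi ∧ ContinuousOn f s ∧ ContinuousOn g s ∧
  ∀ r ∈ s,
    HasDerivAt f (g r * ((f r) ^ 2 - a * (g r) ^ 2 + b) - 2 * φ (f r) (g r) / (ρ + r) * f r) r ∧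
    HasDerivAt g (f r * (1 - (g r) ^ 2)) r

/-- The interval `[0, R)` with possibly infinite right endpoint. -/
def edom (R : EReal) : Set ℝ := {r : ℝ | 0 ≤ r ∧ (r : EReal) < R}

/-- `g` changes sign at `r₀` relative to the interval `s`. -/
def ChangesSignAt (g : ℝ → ℝ) (s : Set ℝ) (r₀ : ℝ) : Prop :=
  g r₀ = 0 ∧ ∃ ε > 0, Icc (r₀ - ε) (r₀ + ε) ⊆ s ∧
    g (r₀ - ε) * g (r₀ + ε) < 0 ∧ ∀ r ∈ Ioo (0 : ℝ) ε, g (r₀ - r) * g (r₀ + r) ≤ 0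

/-- `g` changes sign exactly `k` times on `s`. -/
def ChangesSignExactly (g : ℝ → ℝ) (s : Set ℝ) (k : ℕ) : Prop :=
  {r | ChangesSignAt g s r}.Finite ∧ {r | ChangesSignAt g s r}.ncard = k

/-- The set `A_k`, for the family of solutions `x ↦ (F x, G x)`. -/
def Aset (a b : ℝ) (F G : ℝ → ℝ → ℝ) (k : ℕ) : Set ℝ :=
  {x | x ∈ Ioo (0 : ℝ) 1 ∧
    (∃ L, L < 0 ∧ Tendsto (fun r => Ham a b (F x r) (G x r)) atTop (nhds L)) ∧
    ChangesSignExactly (G x) (Ioi 0) k}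

/-- The set `I_k`, for the family of solutions `x ↦ (F x, G x)`. -/
def Iset (a b : ℝ) (F G : ℝ → ℝ → ℝ) (k : ℕ) : Set ℝ :=
  {x | x ∈ Ioo (0 : ℝ) 1 ∧
    Tendsto (fun r => (F x r, G x r)) atTop (nhds ((0 : ℝ), (0 : ℝ))) ∧
    ChangesSignExactly (G x) (Ioi 0) k}

/-- A continuous function with nonpositive derivative does not increase. -/
theorem le_of_hasDerivAt_nonpos {u u' : ℝ → ℝ} {A B : ℝ} (hAB : A ≤ B)
    (hc : ContinuousOn u (Icc A B)) (hd : ∀ t ∈ Ioo A B, HasDerivAt u (u' t) t)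
    (hn : ∀ t ∈ Ioo A B, u' t ≤ 0) : u B ≤ u A := by
  have : AntitoneOn u (Icc A B) := by
    refine antitoneOn_of_hasDerivWithinAt_nonpos (f' := u') (convex_Icc A B) hc ?_ ?_
    · intro t ht
      rw [interior_Icc] at ht ⊢
      exact (hd t ht).hasDerivWithinAt
    · intro t ht
      rw [interior_Icc] at ht
      exact hn t ht
  exact this (left_mem_Icc.2 hAB) (right_mem_Icc.2 hAB) hAB

/-- Gronwall's inequality in differential form. -/
theorem le_mul_exp_of_hasDerivAt_le {u u' : ℝ → ℝ} {A B C : ℝ} (hAB : A ≤ B)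
    (hc : ContinuousOn u (Icc A B)) (hd : ∀ t ∈ Ioo A B, HasDerivAt u (u' t) t)
    (hn : ∀ t ∈ Ioo A B, u' t ≤ C * u t) : u B ≤ u A * exp (C * (B - A)) := by
  have h := le_of_hasDerivAt_nonpos (u := fun t => u t * exp (-C * (t - A)))
    (u' := fun t => (u' t - C * u t) * exp (-C * (t - A))) hAB
    (hc.mul (by fun_prop)) (fun t ht => by
      have h1 : HasDerivAt (fun t : ℝ => exp (-C * (t - A))) (exp (-C * (t - A)) * (-C * 1)) t :=
        (((hasDerivAt_id t).sub_const A).const_mul (-C)).exp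
      exact ((hd t ht).mul h1).congr_deriv (by ring))
    (fun t ht => mul_nonpos_of_nonpos_of_nonneg (by linarith [hn t ht]) (exp_pos _).le)
  simp only [sub_self, mul_zero, exp_zero, mul_one] at h
  have h2 : u B = u B * exp (-C * (B - A)) * exp (C * (B - A)) := by
    rw [mul_assoc, ← exp_add]; simp
  rw [h2]
  exact mul_le_mul_of_nonneg_right h (exp_pos _).le

/-- Backward Gronwall inequality: a quantity whose relative decay rate is bounded stays positive. -/
theorem le_mul_exp_of_le_hasDerivAt {u u' : ℝ → ℝ} {A B C : ℝ} (hAB : A ≤ B)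
    (hc : ContinuousOn u (Icc A B)) (hd : ∀ t ∈ Ioo A B, HasDerivAt u (u' t) t)
    (hn : ∀ t ∈ Ioo A B, -(C * u t) ≤ u' t) : u A ≤ u B * exp (C * (B - A)) := by
  have h := le_mul_exp_of_hasDerivAt_le (u := fun t => -u t) (u' := fun t => -u' t) (C := -C) hAB
    hc.neg (fun t ht => (hd t ht).neg) (fun t ht => by linarith [hn t ht])
  have h2 : exp (-C * (B - A)) * exp (C * (B - A)) = 1 := by
    rw [← exp_add]; simp
  have h3 : u A * exp (-C * (B - A)) ≤ u B := by linarith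
  have h4 := mul_le_mul_of_nonneg_right h3 (exp_pos (C * (B - A))).le
  rwa [mul_assoc, h2, mul_one] at h4

/-- If a function and its derivative both converge at infinity, the derivative converges to `0`. -/
theorem eq_zero_of_tendsto_of_tendsto_deriv {h h' : ℝ → ℝ} {l c : ℝ}
    (hd : ∀ r, 0 < r → HasDerivAt h (h' r) r) (hl : Tendsto h atTop (𝓝 l))
    (hc : Tendsto h' atTop (𝓝 c)) : c = 0 := by
  have key : ∀ r : ℝ, ∃ ξ, r ≤ ξ ∧ (0 < r → h' ξ = h (r + 1) - h r) := by
    intro r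
    by_cases hr : 0 < r
    · obtain ⟨ξ, hξ, he⟩ := exists_hasDerivAt_eq_slope h h' (lt_add_one r)
        (fun t ht => (hd t (hr.trans_le ht.1)).continuousAt.continuousWithinAt)
        (fun t ht => hd t (hr.trans ht.1))
      exact ⟨ξ, hξ.1.le, fun _ => by rw [he]; simp⟩
    · exact ⟨r, le_rfl, fun h => absurd h hr⟩
  choose ξ hξ he using key
  have h1 : Tendsto (fun r => h' (ξ r)) atTop (𝓝 c) :=
    hc.comp (tendsto_atTop_mono hξ tendsto_id)
  have h2 : Tendsto (fun r => h (r + 1) - h r) atTop (𝓝 (l - l)) :=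
    (hl.comp (tendsto_atTop_add_const_right _ 1 tendsto_id)).sub hl
  rw [sub_self] at h2
  refine tendsto_nhds_unique h1 (h2.congr' ?_)
  filter_upwards [eventually_gt_atTop 0] with r hr using (he r hr).symm

/-- A function that is eventually monotone and bounded converges at infinity. -/
theorem exists_tendsto_of_monotoneOn_Ici {h : ℝ → ℝ} {R M : ℝ} (hm : MonotoneOn h (Ici R))
    (hM : ∀ r ∈ Ici R, h r ≤ M) : ∃ l, Tendsto h atTop (𝓝 l) := by
  have h1 : Monotone fun r => h (max r R) := fun r t hrt =>
    hm (mem_Ici.2 (le_max_right _ _)) (mem_Ici.2 (le_max_right _ _)) (max_le_max_right _ hrt)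
  refine ⟨_, (tendsto_atTop_ciSup h1 ⟨M, ?_⟩).congr' ?_⟩
  · rintro _ ⟨r, rfl⟩
    exact hM _ (mem_Ici.2 (le_max_right _ _))
  · filter_upwards [eventually_ge_atTop R] with r hr
    rw [max_eq_left hr]

theorem exists_tendsto_of_antitoneOn_Ici {h : ℝ → ℝ} {R M : ℝ} (hm : AntitoneOn h (Ici R))
    (hM : ∀ r ∈ Ici R, M ≤ h r) : ∃ l, Tendsto h atTop (𝓝 l) := by
  obtain ⟨l, hl⟩ := exists_tendsto_of_monotoneOn_Ici (h := fun r => -h r) (M := -M) hm.neg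
    (fun r hr => neg_le_neg (hM r hr))
  exact ⟨-l, by simpa using hl.neg⟩

/-- `(f, g)` is a global solution of the regularized Cauchy problem with admissible parameters and
initial datum `x ∈ (-1, 1) \ {0}`. -/
structure DampedSol (a b η : ℝ) (φ : ℝ → ℝ → ℝ) (x : ℝ) (f g : ℝ → ℝ) : Prop where
  hb : 0 < b
  hab : 2 * b < a
  hη : η ∈ Ioo 0 (√(a - b) - √(a / 2))
  hφ : IsCutoff a b η φ
  sol : IsRegSolOn a b φ x f g (Ici 0)
  hx : x ^ 2 < 1
  hx0 : x ≠ 0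

theorem Ham_neg (a b f g : ℝ) : Ham a b (-f) (-g) = Ham a b f g := by
  unfold Ham; ring

theorem Ham_sub_max (a b f g : ℝ) : a / 4 - b / 2 - Ham a b f g =
    (1 - g ^ 2) * (a / 4 * (1 + g ^ 2) - b / 2 - f ^ 2 / 2) := by
  unfold Ham; ring

theorem tendsto_Ham {ι : Type*} {l : Filter ι} {a b p q : ℝ} {u v : ι → ℝ}
    (hu : Tendsto u l (𝓝 p)) (hv : Tendsto v l (𝓝 q)) :
    Tendsto (fun i => Ham a b (u i) (v i)) l (𝓝 (Ham a b p q)) :=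
  ((((hu.pow 2).const_mul _).mul ((hv.pow 2).const_sub 1)).add ((hv.pow 4).const_mul _)).sub
    ((hv.pow 2).const_mul _)

/-- Low energy forces `f` to be small. -/
theorem sq_lt_of_Ham_lt {a b f g : ℝ} (hb : 0 < b) (hab : 2 * b < a) (hg : g ^ 2 < 1)
    (h : Ham a b f g < 3 / 16 * (a - 2 * b)) : f ^ 2 < a / 2 := by
  by_contra! hf
  have h1 : a / 2 * (1 - g ^ 2) ≤ f ^ 2 * (1 - g ^ 2) :=
    mul_le_mul_of_nonneg_right hf (by linarith)
  have h2 : Ham a b f g = 1 / 2 * (f ^ 2 * (1 - g ^ 2)) + a / 4 * (g ^ 2) ^ 2 - b / 2 * g ^ 2 := by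
    unfold Ham; ring
  nlinarith [mul_nonneg hb.le (sq_nonneg (1 - g ^ 2)), mul_nonneg (sub_pos.2 hab).le
    (sq_nonneg (g ^ 2 - 1 / 2))]

namespace DampedSol

variable {a b η x : ℝ} {φ : ℝ → ℝ → ℝ} {f g : ℝ → ℝ}

theorem neg (h : DampedSol a b η φ x f g) :
    DampedSol a b η φ (-x) (fun r => -f r) (fun r => -g r) where
  hb := h.hb
  hab := h.hab
  hη := h.hη
  hφ := h.hφ
  hx := by simpa using h.hx
  hx0 := by simpa using h.hx0
  sol := by
    obtain ⟨h1, h2, h3, h4, h5⟩ := h.sol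
    refine ⟨by simp [h1], by simp [h2], h3.neg, h4.neg, fun r hr hr0 => ?_⟩
    have he : φ (-f r) (-g r) = φ (f r) (g r) := by
      rw [h.hφ.2.2.1 (-f r), h.hφ.2.2.1 (f r), abs_neg, abs_neg]
    obtain ⟨h6, h7⟩ := h5 r hr hr0
    exact ⟨h6.neg.congr_deriv (by rw [he]; ring), h7.neg.congr_deriv (by ring)⟩

theorem a_pos (h : DampedSol a b η φ x f g) : 0 < a := by linarith [h.hb, h.hab]

theorem sqrt_pos (h : DampedSol a b η φ x f g) : 0 < √(a - b) :=
  Real.sqrt_pos.2 (by linarith [h.hb, h.hab])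

theorem sq_sqrt (h : DampedSol a b η φ x f g) : √(a - b) ^ 2 = a - b :=
  Real.sq_sqrt (by linarith [h.hb, h.hab])

theorem cutoff_nonneg (h : DampedSol a b η φ x f g) (u v : ℝ) : 0 ≤ φ u v := (h.hφ.1 u v).1

theorem cutoff_le_one (h : DampedSol a b η φ x f g) (u v : ℝ) : φ u v ≤ 1 := (h.hφ.1 u v).2

theorem cutoff_eq_one (h : DampedSol a b η φ x f g) {u : ℝ} (v : ℝ) (hu : u ^ 2 ≤ a / 2) :
    φ u v = 1 := by
  apply h.hφ.2.2.2.2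
  have := Real.abs_le_sqrt hu
  linarith [h.hη.2]

theorem continuousOn_f (h : DampedSol a b η φ x f g) : ContinuousOn f (Ici 0) := h.sol.2.2.1

theorem continuousOn_g (h : DampedSol a b η φ x f g) : ContinuousOn g (Ici 0) := h.sol.2.2.2.1

theorem hasDerivAt_f (h : DampedSol a b η φ x f g) {r : ℝ} (hr : 0 < r) :
    HasDerivAt f (g r * (f r ^ 2 - a * g r ^ 2 + b) - 2 * φ (f r) (g r) / r * f r) r :=
  (h.sol.2.2.2.2 r hr.le hr).1

theorem hasDerivAt_g (h : DampedSol a b η φ x f g) {r : ℝ} (hr : 0 < r) :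
    HasDerivAt g (f r * (1 - g r ^ 2)) r :=
  (h.sol.2.2.2.2 r hr.le hr).2

theorem continuousAt_f (h : DampedSol a b η φ x f g) {r : ℝ} (hr : 0 < r) : ContinuousAt f r :=
  (h.hasDerivAt_f hr).continuousAt

theorem continuousAt_g (h : DampedSol a b η φ x f g) {r : ℝ} (hr : 0 < r) : ContinuousAt g r :=
  (h.hasDerivAt_g hr).continuousAt

theorem continuousOn_f_Icc (h : DampedSol a b η φ x f g) {A B : ℝ} (hA : 0 ≤ A) :
    ContinuousOn f (Icc A B) := h.continuousOn_f.mono fun _ ht => hA.trans ht.1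

theorem continuousOn_g_Icc (h : DampedSol a b η φ x f g) {A B : ℝ} (hA : 0 ≤ A) :
    ContinuousOn g (Icc A B) := h.continuousOn_g.mono fun _ ht => hA.trans ht.1

theorem continuousOn_Ham (h : DampedSol a b η φ x f g) :
    ContinuousOn (fun r => Ham a b (f r) (g r)) (Ici 0) := by
  have hf := h.continuousOn_f
  have hg := h.continuousOn_g
  unfold Ham
  fun_prop

theorem g_sq_lt_one (h : DampedSol a b η φ x f g) {r : ℝ} (hr : 0 ≤ r) : g r ^ 2 < 1 := by
  have hne : ∀ r, 0 ≤ r → 1 - g r ^ 2 ≠ 0 := by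
    intro r hr h0
    have hcf := h.continuousOn_f_Icc (A := 0) (B := r) le_rfl
    have hcg := h.continuousOn_g_Icc (A := 0) (B := r) le_rfl
    obtain ⟨M, hM⟩ := isCompact_Icc.exists_bound_of_continuousOn (hcf.mul hcg)
    have := le_mul_exp_of_le_hasDerivAt (u := fun t => (1 - g t ^ 2) ^ 2)
      (u' := fun t => -4 * (f t * g t) * (1 - g t ^ 2) ^ 2) (C := 4 * M) hr (by fun_prop)
      (fun t ht => by
        exact ((((h.hasDerivAt_g ht.1).pow 2).const_sub 1).pow 2).congr_deriv
          (by simp only [Pi.pow_apply]; push_cast; ring))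
      (fun t ht => by
        have h1 : |f t * g t| ≤ M := hM t (Ioo_subset_Icc_self ht)
        have h1 := abs_le.1 h1
        nlinarith [sq_nonneg (1 - g t ^ 2)])
    simp only [h0, h.sol.2.1] at this
    have h2 := h.hx
    have h3 : 0 < (1 - x ^ 2) ^ 2 := by apply pow_pos; linarith
    norm_num at this
    linarith
  by_contra! hc
  have h0 : (0 : ℝ) ∈ Icc (1 - g r ^ 2) (1 - g 0 ^ 2) := by
    rw [h.sol.2.1]; constructor <;> linarith [h.hx]
  have hcg := h.continuousOn_g_Icc (A := 0) (B := r) le_rfl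
  obtain ⟨t, ht, h1⟩ := intermediate_value_Icc' (f := fun t => 1 - g t ^ 2) hr (by fun_prop) h0
  exact hne t ht.1 h1

theorem hasDerivAt_Ham (h : DampedSol a b η φ x f g) {r : ℝ} (hr : 0 < r) :
    HasDerivAt (fun r => Ham a b (f r) (g r))
      (-(2 * φ (f r) (g r) / r * f r ^ 2 * (1 - g r ^ 2))) r := by
  have hf := h.hasDerivAt_f hr
  have hg := h.hasDerivAt_g hr
  unfold Ham
  refine (((((hf.pow 2).const_mul (1 / 2)).mul ((hg.pow 2).const_sub 1)).add
    ((hg.pow 4).const_mul (a / 4))).sub ((hg.pow 2).const_mul (b / 2))).congr_deriv ?_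
  simp only [Pi.pow_apply]
  push_cast
  ring

theorem Ham_deriv_nonpos (h : DampedSol a b η φ x f g) {r : ℝ} (hr : 0 < r) :
    -(2 * φ (f r) (g r) / r * f r ^ 2 * (1 - g r ^ 2)) ≤ 0 := by
  have := h.cutoff_nonneg (f r) (g r)
  have := sub_pos.2 (h.g_sq_lt_one hr.le)
  rw [neg_nonpos]
  positivity

theorem Ham_antitone (h : DampedSol a b η φ x f g) {r t : ℝ} (hr : 0 ≤ r) (hrt : r ≤ t) :
    Ham a b (f t) (g t) ≤ Ham a b (f r) (g r) :=
  le_of_hasDerivAt_nonpos hrt (h.continuousOn_Ham.mono fun _ hs => hr.trans hs.1)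
    (fun _ hs => h.hasDerivAt_Ham (hr.trans_lt hs.1))
    (fun _ hs => h.Ham_deriv_nonpos (hr.trans_lt hs.1))

theorem Ham_zero_lt (h : DampedSol a b η φ x f g) : Ham a b (f 0) (g 0) < a / 4 - b / 2 := by
  have := Ham_sub_max a b (f 0) (g 0)
  rw [h.sol.1, h.sol.2.1] at *
  have h1 : 0 < (1 - x ^ 2) * (a / 4 * (1 + x ^ 2) - b / 2 - 0 ^ 2 / 2) :=
    mul_pos (by linarith [h.hx]) (by nlinarith [h.hab, mul_nonneg h.a_pos.le (sq_nonneg x)])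
  linarith

theorem f_sq_lt (h : DampedSol a b η φ x f g) {r : ℝ} (hr : 0 ≤ r) : f r ^ 2 < a - b := by
  have h1 := h.g_sq_lt_one hr
  have h2 := Ham_sub_max a b (f r) (g r)
  have h3 := h.Ham_antitone le_rfl hr
  have h4 := h.Ham_zero_lt
  have h5 : 0 < (1 - g r ^ 2) * (a / 4 * (1 + g r ^ 2) - b / 2 - f r ^ 2 / 2) := by linarith
  have h6 := (mul_pos_iff_of_pos_left (by linarith)).1 h5
  nlinarith [h.a_pos]

theorem abs_f_lt (h : DampedSol a b η φ x f g) {r : ℝ} (hr : 0 ≤ r) : |f r| < √(a - b) :=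
  Real.lt_sqrt_of_sq_lt (by rw [sq_abs]; exact h.f_sq_lt hr)

theorem abs_g_lt_one (h : DampedSol a b η φ x f g) {r : ℝ} (hr : 0 ≤ r) : |g r| < 1 :=
  (sq_lt_one_iff_abs_lt_one _).1 (h.g_sq_lt_one hr)

theorem abs_force_le (h : DampedSol a b η φ x f g) {r : ℝ} (hr : 0 ≤ r) :
    |f r ^ 2 - a * g r ^ 2 + b| ≤ a := by
  have h1 := h.g_sq_lt_one hr
  have h2 := h.f_sq_lt hr
  have := h.hb
  have := h.a_pos
  rw [abs_le]
  constructor <;> nlinarith [sq_nonneg (g r), sq_nonneg (f r)]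

/-- A nontrivial solution never reaches the origin. -/
theorem ne_zero (h : DampedSol a b η φ x f g) {r : ℝ} (hr : 0 ≤ r) :
    ¬ (f r = 0 ∧ g r = 0) := by
  rintro ⟨hf0, hg0⟩
  have ha := h.a_pos
  have key : ∀ ε ∈ Ioc 0 r, f ε ^ 2 + g ε ^ 2 = 0 := by
    intro ε hε
    have hcf := h.continuousOn_f_Icc (A := ε) (B := r) hε.1.le
    have hcg := h.continuousOn_g_Icc (A := ε) (B := r) hε.1.le
    have := le_mul_exp_of_le_hasDerivAt (u := fun t => f t ^ 2 + g t ^ 2)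
      (u' := fun t => 2 * (f t * g t) * ((f t ^ 2 - a * g t ^ 2 + b) + (1 - g t ^ 2)) -
        4 * φ (f t) (g t) / t * f t ^ 2) (C := a + 1 + 4 / ε) hε.2 (by fun_prop)
      (fun t ht => by
        have ht0 := hε.1.trans ht.1
        exact (((h.hasDerivAt_f ht0).pow 2).add ((h.hasDerivAt_g ht0).pow 2)).congr_deriv
          (by push_cast; ring))
      (fun t ht => by
        have ht0 := hε.1.trans ht.1
        have h1 := abs_le.1 (h.abs_force_le ht0.le)
        have h2 := h.g_sq_lt_one ht0.le
        have h3 : φ (f t) (g t) / t ≤ 1 / ε :=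
          div_le_div₀ zero_le_one (h.cutoff_le_one _ _) hε.1 ht.1.le
        have h4 : φ (f t) (g t) / t * f t ^ 2 ≤ 1 / ε * (f t ^ 2 + g t ^ 2) :=
          mul_le_mul h3 (by nlinarith [sq_nonneg (g t)]) (sq_nonneg _) (by have := hε.1; positivity)
        have h5 : |2 * (f t * g t) * ((f t ^ 2 - a * g t ^ 2 + b) + (1 - g t ^ 2))| ≤
            (f t ^ 2 + g t ^ 2) * (a + 1) := by
          rw [abs_mul]
          refine mul_le_mul ?_ ?_ (abs_nonneg _) (by positivity)
          · rw [abs_le]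
            constructor <;> nlinarith [sq_nonneg (f t + g t), sq_nonneg (f t - g t)]
          · rw [abs_le]
            constructor <;> nlinarith [sq_nonneg (g t)]
        have h6 := (abs_le.1 h5).1
        have h7 : 4 * φ (f t) (g t) / t * f t ^ 2 = 4 * (φ (f t) (g t) / t * f t ^ 2) := by ring
        have h8 : (a + 1 + 4 / ε) * (f t ^ 2 + g t ^ 2) =
          (f t ^ 2 + g t ^ 2) * (a + 1) + 4 * (1 / ε * (f t ^ 2 + g t ^ 2)) := by ring
        rw [h7, h8]
        linarith)
    simp only [hf0, hg0] at this
    norm_num at this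
    nlinarith [sq_nonneg (f ε), sq_nonneg (g ε)]
  have hg : ∀ ε ∈ Ioc 0 r, g ε = 0 := fun ε hε => by
    have := key ε hε
    exact pow_eq_zero_iff two_ne_zero |>.1 (by nlinarith [sq_nonneg (f ε), sq_nonneg (g ε)])
  rcases hr.eq_or_lt with rfl | hr
  · exact h.hx0 (h.sol.2.1 ▸ hg0)
  · have h1 : Tendsto g (𝓝[>] 0) (𝓝 (g 0)) :=
      (h.continuousOn_g 0 self_mem_Ici).mono_left (nhdsWithin_mono _ Ioi_subset_Ici_self)
    have h2 : Tendsto g (𝓝[>] 0) (𝓝 0) := by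
      refine tendsto_const_nhds.congr' ?_
      filter_upwards [Ioc_mem_nhdsGT hr] with t ht using (hg t ht).symm
    exact h.hx0 (h.sol.2.1 ▸ tendsto_nhds_unique h1 h2)

/-- Nonnegative energy is automatically positive. -/
theorem Ham_pos_of_nonneg (h : DampedSol a b η φ x f g)
    (hH : ∀ r, 0 ≤ r → 0 ≤ Ham a b (f r) (g r)) {r : ℝ} (hr : 0 ≤ r) :
    0 < Ham a b (f r) (g r) := by
  refine (hH r hr).lt_of_ne fun h0 => ?_
  have hz : ∀ t, r ≤ t → Ham a b (f t) (g t) = 0 := fun t ht =>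
    le_antisymm (h0 ▸ h.Ham_antitone hr ht) (hH t (hr.trans ht))
  have hf : ∀ t, r < t → f t = 0 := by
    intro t ht
    have ht0 := hr.trans_lt ht
    have h1 : HasDerivAt (fun r => Ham a b (f r) (g r)) 0 t := by
      refine (hasDerivAt_const t (0 : ℝ)).congr_of_eventuallyEq ?_
      filter_upwards [Ioi_mem_nhds ht] with u hu using hz u (le_of_lt hu)
    have h2 := h1.unique (h.hasDerivAt_Ham ht0)
    have h3 := h.g_sq_lt_one ht0.le
    rw [h.cutoff_eq_one (g t) (sq_lt_of_Ham_lt h.hb h.hab h3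
      (by rw [hz t ht.le]; linarith [h.hab])).le] at h2
    have h4 : 0 < 2 * 1 / t * (1 - g t ^ 2) := mul_pos (by positivity) (by linarith)
    have h5 : 2 * 1 / t * (1 - g t ^ 2) * f t ^ 2 = 0 := by linarith
    exact pow_eq_zero_iff two_ne_zero |>.1 ((mul_eq_zero.1 h5).resolve_left h4.ne')
  have hr1 : r < r + 1 := lt_add_one r
  have hr0 : 0 < r + 1 := by linarith
  have h1 : HasDerivAt f 0 (r + 1) := by
    refine (hasDerivAt_const _ (0 : ℝ)).congr_of_eventuallyEq ?_
    filter_upwards [Ioi_mem_nhds hr1] with u hu using hf u hu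
  have h2 := h1.unique (h.hasDerivAt_f hr0)
  have h3 := hz _ hr1.le
  unfold Ham at h3
  have h4 : g (r + 1) ≠ 0 := fun h4 => h.ne_zero hr0.le ⟨hf _ hr1, h4⟩
  rw [hf _ hr1] at h2 h3
  have h5 : a * g (r + 1) ^ 2 = b := by
    have : g (r + 1) * (b - a * g (r + 1) ^ 2) = 0 := by linarith
    rcases mul_eq_zero.1 this with h6 | h6
    · exact absurd h6 h4
    · linarith
  have h6 : b / 4 * g (r + 1) ^ 2 = 0 := by
    rw [show a / 4 * g (r + 1) ^ 4 = a * g (r + 1) ^ 2 / 4 * g (r + 1) ^ 2 by ring, h5] at h3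
    linarith
  have := h.hb
  simp [this.ne', h4] at h6

theorem Ham_pos_of_tendsto (h : DampedSol a b η φ x f g)
    (ht : Tendsto (fun r => (f r, g r)) atTop (𝓝 ((0 : ℝ), (0 : ℝ)))) {r : ℝ} (hr : 0 ≤ r) :
    0 < Ham a b (f r) (g r) := by
  refine h.Ham_pos_of_nonneg (fun r hr => ?_) hr
  have h1 : Tendsto (fun r => Ham a b (f r) (g r)) atTop (𝓝 (Ham a b 0 0)) :=
    tendsto_Ham ht.fst_nhds ht.snd_nhds
  rw [show Ham a b 0 0 = 0 by unfold Ham; ring] at h1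
  refine le_of_tendsto h1 ?_
  filter_upwards [eventually_ge_atTop r] with t htr using h.Ham_antitone hr htr

theorem lt_of_f_eq_zero {a b v : ℝ} (hH : 0 < Ham a b 0 v) : 2 * b < a * v ^ 2 := by
  have h1 : Ham a b 0 v = v ^ 2 * (a * v ^ 2 - 2 * b) / 4 := by unfold Ham; ring
  rw [h1] at hH
  by_contra! hc
  nlinarith [mul_nonneg (sq_nonneg v) (sub_nonneg.2 hc)]

theorem f_ne_zero_of_g_eq_zero {a b u : ℝ} (hH : 0 < Ham a b u 0) : u ≠ 0 := by
  rintro rfl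
  simp [Ham] at hH

/-- On an interval where `g ≥ 0` and the energy is positive, `f` can only change sign from positive
to negative. -/
theorem f_nonpos_of_le (h : DampedSol a b η φ x f g)
    (hH : ∀ r, 0 ≤ r → 0 < Ham a b (f r) (g r)) {u ρ : ℝ} (hu : 0 < u)
    (hg : ∀ t ∈ Icc u ρ, 0 ≤ g t) (hfu : f u ≤ 0) : ∀ t ∈ Icc u ρ, f t ≤ 0 := by
  refine image_le_of_deriv_right_lt_deriv_boundary (B := fun _ => 0) (B' := fun _ => 0)
    (h.continuousOn_f_Icc hu.le)
    (fun t ht => (h.hasDerivAt_f (hu.trans_le ht.1)).hasDerivWithinAt) hfu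
    (fun t => hasDerivAt_const t 0) (fun t ht hft => ?_)
  have ht0 := hu.trans_le ht.1
  have h1 := hH t ht0.le
  rw [hft] at h1 ⊢
  have h2 := lt_of_f_eq_zero h1
  have hb := h.hb
  have h3 : g t ≠ 0 := by
    intro h3
    rw [h3] at h2
    linarith
  have h4 : 0 < g t := (hg t (Ico_subset_Icc_self ht)).lt_of_ne h3.symm
  nlinarith

/-- Energy loss while `g` increases. -/
theorem Ham_le_of_f_nonneg (h : DampedSol a b η φ x f g) {r₀ A B : ℝ} (hr₀ : 0 < r₀)
    (hA : r₀ ≤ A) (hAB : A ≤ B) (hf : ∀ t ∈ Icc A B, 0 ≤ f t) :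
    Ham a b (f A) (g A) ≤ Ham a b (f B) (g B) + 2 * √(a - b) / r₀ * (g B - g A) := by
  have hA0 := hr₀.trans_le hA
  have hcH : ContinuousOn (fun r => Ham a b (f r) (g r)) (Icc A B) :=
    h.continuousOn_Ham.mono fun _ hs => hA0.le.trans hs.1
  have hcg := h.continuousOn_g_Icc (A := A) (B := B) hA0.le
  have := le_of_hasDerivAt_nonpos
    (u := fun t => -Ham a b (f t) (g t) - 2 * √(a - b) / r₀ * g t)
    (u' := fun t => -(-(2 * φ (f t) (g t) / t * f t ^ 2 * (1 - g t ^ 2))) -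
      2 * √(a - b) / r₀ * (f t * (1 - g t ^ 2))) hAB
    (hcH.neg.sub (hcg.const_mul _)) (fun t ht => by
      have ht0 := hA0.trans ht.1
      exact (h.hasDerivAt_Ham ht0).neg.sub ((h.hasDerivAt_g ht0).const_mul _))
    (fun t ht => by
      have ht0 := hA0.trans ht.1
      have h1 := h.g_sq_lt_one ht0.le
      have h2 := hf t (Ioo_subset_Icc_self ht)
      have h3 : φ (f t) (g t) * f t / t ≤ √(a - b) / r₀ := by
        refine div_le_div₀ h.sqrt_pos.le ?_ hr₀ (hA.trans ht.1.le)
        have h4 := (abs_lt.1 (h.abs_f_lt ht0.le)).2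
        nlinarith [h.cutoff_le_one (f t) (g t)]
      have h5 : 0 ≤ f t * (1 - g t ^ 2) := mul_nonneg h2 (by linarith)
      have h6 := mul_le_mul_of_nonneg_left h3 h5
      have e1 : -(-(2 * φ (f t) (g t) / t * f t ^ 2 * (1 - g t ^ 2))) =
        2 * (f t * (1 - g t ^ 2) * (φ (f t) (g t) * f t / t)) := by ring
      have e2 : 2 * √(a - b) / r₀ * (f t * (1 - g t ^ 2)) =
        2 * (f t * (1 - g t ^ 2) * (√(a - b) / r₀)) := by ring
      rw [e1, e2]
      linarith)
  linarith

/-- Energy loss while `g` decreases. -/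
theorem Ham_le_of_f_nonpos (h : DampedSol a b η φ x f g) {r₀ A B : ℝ} (hr₀ : 0 < r₀)
    (hA : r₀ ≤ A) (hAB : A ≤ B) (hf : ∀ t ∈ Icc A B, f t ≤ 0) :
    Ham a b (f A) (g A) ≤ Ham a b (f B) (g B) + 2 * √(a - b) / r₀ * (g A - g B) := by
  have := h.neg.Ham_le_of_f_nonneg hr₀ hA hAB (fun t ht => neg_nonneg.2 (hf t ht))
  simp only [Ham_neg] at this
  linarith

/-- Energy loss on an interval where `g ≥ 0`. -/
theorem Ham_le_of_g_nonneg (h : DampedSol a b η φ x f g)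
    (hH : ∀ r, 0 ≤ r → 0 < Ham a b (f r) (g r)) {r₀ A B : ℝ} (hr₀ : 0 < r₀)
    (hA : r₀ ≤ A) (hAB : A ≤ B) (hg : ∀ t ∈ Icc A B, 0 ≤ g t) :
    Ham a b (f A) (g A) ≤ Ham a b (f B) (g B) + 4 * √(a - b) / r₀ := by
  have hA0 := hr₀.trans_le hA
  have hC : 0 ≤ 2 * √(a - b) / r₀ := by have := h.sqrt_pos; positivity
  have hC4 : 4 * √(a - b) / r₀ = 2 * √(a - b) / r₀ + 2 * √(a - b) / r₀ := by ring
  have hstep : ∀ s ∈ Icc A B, ∀ t ∈ Icc A B, 2 * √(a - b) / r₀ * (g s - g t) ≤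
      2 * √(a - b) / r₀ := fun s hs t ht => by
    have h1 := (abs_lt.1 (h.abs_g_lt_one (hA0.le.trans hs.1))).2
    have h2 := hg t ht
    exact mul_le_of_le_one_right hC (by linarith)
  have hl := left_mem_Icc.2 hAB
  have hr := right_mem_Icc.2 hAB
  by_cases hpos : ∀ t ∈ Icc A B, 0 < f t
  · have := h.Ham_le_of_f_nonneg hr₀ hA hAB (fun t ht => (hpos t ht).le)
    linarith [hstep B hr A hl]
  · push Not at hpos
    obtain ⟨v, hv, hfv⟩ := hpos
    have hcomp : IsCompact (Icc A B ∩ f ⁻¹' Iic 0) :=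
      isCompact_Icc.of_isClosed_subset
        ((h.continuousOn_f_Icc hA0.le).preimage_isClosed_of_isClosed isClosed_Icc isClosed_Iic)
        inter_subset_left
    obtain ⟨u, ⟨hu, hfu⟩, hmin⟩ := hcomp.exists_isLeast ⟨v, hv, hfv⟩
    have h1 : ∀ t ∈ Ico A u, 0 ≤ f t := fun t ht => by
      by_contra! hc
      exact absurd (hmin ⟨⟨ht.1, ht.2.le.trans hu.2⟩, hc.le⟩) (not_le.2 ht.2)
    have h2 := h.f_nonpos_of_le hH (hA0.trans_le hu.1)
      (fun t ht => hg t ⟨hu.1.trans ht.1, ht.2⟩) hfu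
    have h3 := h.Ham_le_of_f_nonpos hr₀ (hA.trans hu.1) hu.2 h2
    have h5 := hstep u hu B hr
    rcases hu.1.eq_or_lt with rfl | hlt
    · linarith
    · have h6 : ∀ t ∈ Icc A u, 0 ≤ f t := by
        have hcl : IsClosed (Icc A u ∩ f ⁻¹' Ici 0) :=
          (h.continuousOn_f_Icc hA0.le).preimage_isClosed_of_isClosed isClosed_Icc isClosed_Ici
        have hsub : Ico A u ⊆ Icc A u ∩ f ⁻¹' Ici 0 := fun t ht =>
          ⟨Ico_subset_Icc_self ht, h1 t ht⟩
        have := hcl.closure_subset_iff.2 hsub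
        rw [closure_Ico hlt.ne] at this
        exact fun t ht => (this ht).2
      have h4 := h.Ham_le_of_f_nonneg hr₀ hA hu.1 h6
      linarith [hstep u hu A hl]

theorem g_antitoneOn (h : DampedSol a b η φ x f g) {s : Set ℝ} (hs : Convex ℝ s)
    (hs0 : ∀ t ∈ s, 0 < t) (hf : ∀ t ∈ s, f t ≤ 0) : AntitoneOn g s := by
  refine antitoneOn_of_hasDerivWithinAt_nonpos hs
    (fun t ht => (h.continuousAt_g (hs0 t ht)).continuousWithinAt)
    (fun t ht => (h.hasDerivAt_g (hs0 t (interior_subset ht))).hasDerivWithinAt)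
    (fun t ht => ?_)
  have h1 := h.g_sq_lt_one (hs0 t (interior_subset ht)).le
  exact mul_nonpos_of_nonpos_of_nonneg (hf t (interior_subset ht)) (by linarith)

theorem g_monotoneOn (h : DampedSol a b η φ x f g) {s : Set ℝ} (hs : Convex ℝ s)
    (hs0 : ∀ t ∈ s, 0 < t) (hf : ∀ t ∈ s, 0 ≤ f t) : MonotoneOn g s := by
  have := (h.neg.g_antitoneOn hs hs0 (fun t ht => neg_nonpos.2 (hf t ht))).neg
  simpa using this

theorem g_strictMonoOn (h : DampedSol a b η φ x f g) {s : Set ℝ} (hs : Convex ℝ s)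
    (hs0 : ∀ t ∈ s, 0 < t) (hf : ∀ t ∈ s, 0 < f t) : StrictMonoOn g s := by
  refine strictMonoOn_of_hasDerivWithinAt_pos hs
    (fun t ht => (h.continuousAt_g (hs0 t ht)).continuousWithinAt)
    (fun t ht => (h.hasDerivAt_g (hs0 t (interior_subset ht))).hasDerivWithinAt)
    (fun t ht => ?_)
  have h1 := h.g_sq_lt_one (hs0 t (interior_subset ht)).le
  exact mul_pos (hf t (interior_subset ht)) (by linarith)

/-- If `g` is eventually positive, `f` eventually has a sign. -/
theorem eventually_f_sign (h : DampedSol a b η φ x f g)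
    (hH : ∀ r, 0 ≤ r → 0 < Ham a b (f r) (g r)) (hg : ∀ᶠ r in atTop, 0 < g r) :
    ∃ R, 0 < R ∧ (∀ r, R ≤ r → 0 < g r) ∧
      ((∀ r, R ≤ r → 0 < f r) ∨ (∀ r, R ≤ r → f r ≤ 0)) := by
  obtain ⟨R₀, hR₀⟩ := eventually_atTop.1 hg
  set R := max R₀ 1
  have hR : 0 < R := zero_lt_one.trans_le (le_max_right _ _)
  have hgR : ∀ r, R ≤ r → 0 < g r := fun r hr => hR₀ r ((le_max_left _ _).trans hr)
  by_cases hf : ∀ r, R ≤ r → 0 < f r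
  · exact ⟨R, hR, hgR, Or.inl hf⟩
  · push Not at hf
    obtain ⟨u, hu, hfu⟩ := hf
    exact ⟨u, hR.trans_le hu, fun r hr => hgR r (hu.trans hr), Or.inr fun r hr =>
      h.f_nonpos_of_le hH (hR.trans_le hu) (ρ := r) (fun t ht => (hgR t (hu.trans ht.1)).le) hfu r
        ⟨hr, le_rfl⟩⟩

theorem tendsto_zero_of_eventually_pos (h : DampedSol a b η φ x f g)
    (hH : ∀ r, 0 ≤ r → 0 < Ham a b (f r) (g r)) (hg : ∀ᶠ r in atTop, 0 < g r) :
    Tendsto (fun r => (f r, g r)) atTop (𝓝 ((0 : ℝ), (0 : ℝ))) := by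
  obtain ⟨R, hR, hgR, hfR⟩ := h.eventually_f_sign hH hg
  have hRsub : ∀ t ∈ Ici R, 0 < t := fun t ht => hR.trans_le ht
  obtain ⟨L, hL⟩ := exists_tendsto_of_antitoneOn_Ici (h := fun r => Ham a b (f r) (g r)) (R := 0)
    (M := 0) (fun r hr t _ hrt => h.Ham_antitone hr hrt) (fun r hr => (hH r hr).le)
  have hL0 : 0 ≤ L := ge_of_tendsto hL ((eventually_ge_atTop 0).mono fun r hr => (hH r hr).le)
  have hLlt : L < a / 4 - b / 2 := (le_of_tendsto hL ((eventually_ge_atTop 0).mono fun r hr =>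
    h.Ham_antitone le_rfl hr)).trans_lt h.Ham_zero_lt
  obtain ⟨l, hl⟩ : ∃ l, Tendsto g atTop (𝓝 l) := by
    rcases hfR with hf | hf
    · exact exists_tendsto_of_monotoneOn_Ici
        (h.g_monotoneOn (convex_Ici R) hRsub (fun t ht => (hf t ht).le))
        (fun r hr => (abs_lt.1 (h.abs_g_lt_one (hRsub r hr).le)).2.le)
    · exact exists_tendsto_of_antitoneOn_Ici (h.g_antitoneOn (convex_Ici R) hRsub hf)
        (fun r hr => (hgR r hr).le)
  have hl0 : 0 ≤ l := ge_of_tendsto hl (hg.mono fun r hr => hr.le)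
  have hl1 : l ^ 2 < 1 := by
    have hle : l ^ 2 ≤ 1 := le_of_tendsto (hl.pow 2)
      ((eventually_ge_atTop 0).mono fun r hr => (h.g_sq_lt_one hr).le)
    refine hle.lt_of_ne fun heq => ?_
    have h1 : Tendsto (fun r => a / 4 * (g r ^ 2) ^ 2 - b / 2 * g r ^ 2) atTop
        (𝓝 (a / 4 * (l ^ 2) ^ 2 - b / 2 * l ^ 2)) :=
      (((hl.pow 2).pow 2).const_mul _).sub ((hl.pow 2).const_mul _)
    rw [heq] at h1
    have h2 := le_of_tendsto_of_tendsto h1 hL ((eventually_ge_atTop 0).mono fun r hr => by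
      have := h.g_sq_lt_one hr
      have : 0 ≤ f r ^ 2 * (1 - g r ^ 2) := mul_nonneg (sq_nonneg _) (by linarith)
      simp only [Ham]
      linarith)
    linarith
  have hfsq : Tendsto (fun r => f r ^ 2) atTop
      (𝓝 (2 * (L - a / 4 * l ^ 4 + b / 2 * l ^ 2) / (1 - l ^ 2))) := by
    refine Tendsto.congr' ?_ (((((hL.sub ((hl.pow 4).const_mul (a / 4))).add
      ((hl.pow 2).const_mul (b / 2))).const_mul 2).div ((hl.pow 2).const_sub 1)
      (by linarith)))
    filter_upwards [eventually_ge_atTop 0] with r hr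
    have := h.g_sq_lt_one hr
    simp only [Pi.div_apply]
    rw [div_eq_iff (by linarith)]
    unfold Ham
    ring
  obtain ⟨m, hm⟩ : ∃ m, Tendsto f atTop (𝓝 m) := by
    rcases hfR with hf | hf
    · refine ⟨_, hfsq.sqrt.congr' ?_⟩
      filter_upwards [eventually_ge_atTop R] with r hr using Real.sqrt_sq (hf r hr).le
    · refine ⟨_, hfsq.sqrt.neg.congr' ?_⟩
      filter_upwards [eventually_ge_atTop R] with r hr
      rw [← neg_sq, Real.sqrt_sq (by linarith [hf r hr]), neg_neg]
  have hm0 : m = 0 := by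
    have := eq_zero_of_tendsto_of_tendsto_deriv (fun r hr => h.hasDerivAt_g hr) hl
      (hm.mul ((hl.pow 2).const_sub 1))
    exact (mul_eq_zero.1 this).resolve_right (by linarith)
  subst hm0
  have hdamp : Tendsto (fun r => 2 * φ (f r) (g r) / r * f r) atTop (𝓝 0) := by
    refine squeeze_zero_norm' ?_ (tendsto_inv_atTop_zero.const_mul (2 * √(a - b)) |>.trans
      (by rw [mul_zero]))
    filter_upwards [eventually_gt_atTop 0] with r hr
    have h1 := (h.abs_f_lt hr.le).le
    have h2 := h.cutoff_nonneg (f r) (g r)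
    have h3 := h.cutoff_le_one (f r) (g r)
    have e : 2 * φ (f r) (g r) / r * f r = 2 * r⁻¹ * (φ (f r) (g r) * f r) := by ring
    rw [e, norm_mul, Real.norm_of_nonneg (by positivity), norm_mul, Real.norm_of_nonneg h2,
      Real.norm_eq_abs]
    have h4 : φ (f r) (g r) * |f r| ≤ √(a - b) := by nlinarith [abs_nonneg (f r)]
    have h5 := mul_le_mul_of_nonneg_left h4 (by positivity : 0 ≤ 2 * r⁻¹)
    linarith
  have hl2 := eq_zero_of_tendsto_of_tendsto_deriv (fun r hr => h.hasDerivAt_f hr) hm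
    ((hl.mul (((hm.pow 2).sub ((hl.pow 2).const_mul a)).add_const b)).sub hdamp)
  have hl3 : l = 0 := by
    by_contra hne
    have h1 : a * l ^ 2 = b := by
      have : l * (b - a * l ^ 2) = 0 := by linarith
      linarith [(mul_eq_zero.1 this).resolve_left hne]
    have h2 : L = Ham a b 0 l := tendsto_nhds_unique hL (tendsto_Ham hm hl)
    have h3 : Ham a b 0 l = -(b / 4 * l ^ 2) := by
      unfold Ham
      rw [show a / 4 * l ^ 4 = a * l ^ 2 / 4 * l ^ 2 by ring, h1]
      ring
    have hb := h.hb
    have : 0 < b / 4 * l ^ 2 := by positivity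
    linarith
  subst hl3
  exact hm.prodMk_nhds hl

/-- Energy loss between two consecutive zeros of `g`. -/
theorem Ham_le_of_g_ne_zero (h : DampedSol a b η φ x f g)
    (hH : ∀ r, 0 ≤ r → 0 < Ham a b (f r) (g r)) {r₀ A B : ℝ} (hr₀ : 0 < r₀)
    (hA : r₀ ≤ A) (hAB : A ≤ B) (hg : ∀ t ∈ Ioo A B, g t ≠ 0) :
    Ham a b (f A) (g A) ≤ Ham a b (f B) (g B) + 4 * √(a - b) / r₀ := by
  have hA0 := hr₀.trans_le hA
  have hs := h.sqrt_pos
  rcases hAB.eq_or_lt with rfl | hlt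
  · have : 0 < 4 * √(a - b) / r₀ := by positivity
    linarith
  have hcg := h.continuousOn_g_Icc (A := A) (B := B) hA0.le
  have hclos : ∀ s : Set ℝ, IsClosed s → (∀ t ∈ Ioo A B, g t ∈ s) → ∀ t ∈ Icc A B, g t ∈ s := by
    intro s hs hgs
    have hcl : IsClosed (Icc A B ∩ g ⁻¹' s) := hcg.preimage_isClosed_of_isClosed isClosed_Icc hs
    have := hcl.closure_subset_iff.2 fun t ht => ⟨Ioo_subset_Icc_self ht, hgs t ht⟩
    rw [closure_Ioo hlt.ne] at this
    exact fun t ht => (this ht).2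
  by_cases hpos : ∀ t ∈ Ioo A B, 0 ≤ g t
  · exact h.Ham_le_of_g_nonneg hH hr₀ hA hAB (hclos (Ici 0) isClosed_Ici hpos)
  · have hneg : ∀ t ∈ Ioo A B, g t ≤ 0 := by
      push Not at hpos
      obtain ⟨p, hp, hgp⟩ := hpos
      intro q hq
      by_contra! hgq
      obtain ⟨z, hz, hgz⟩ := isPreconnected_Ioo.intermediate_value hp hq
        (hcg.mono Ioo_subset_Icc_self) ⟨hgp.le, hgq.le⟩
      exact hg z hz hgz
    have := h.neg.Ham_le_of_g_nonneg (by simpa only [Ham_neg] using hH) hr₀ hA hAB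
      (fun t ht => neg_nonneg.2 (hclos (Iic 0) isClosed_Iic hneg t ht))
    simpa only [Ham_neg] using this

/-- Energy loss on an interval where `g` has at most `n` zeros. -/
theorem Ham_le_of_ncard_le (h : DampedSol a b η φ x f g)
    (hH : ∀ r, 0 ≤ r → 0 < Ham a b (f r) (g r)) {r₀ : ℝ} (hr₀ : 0 < r₀) (n : ℕ) :
    ∀ A B : ℝ, r₀ ≤ A → A ≤ B → {r | r ∈ Ioo A B ∧ g r = 0}.Finite →
      {r | r ∈ Ioo A B ∧ g r = 0}.ncard ≤ n →
      Ham a b (f A) (g A) ≤ Ham a b (f B) (g B) + (n + 1) * (4 * √(a - b) / r₀) := by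
  have hC : 0 < 4 * √(a - b) / r₀ := by have := h.sqrt_pos; positivity
  induction n with
  | zero =>
    intro A B hA hAB hfin hn
    rw [Nat.le_zero, Set.ncard_eq_zero hfin] at hn
    have := h.Ham_le_of_g_ne_zero hH hr₀ hA hAB (fun t ht hgt => by
      have : t ∈ ({r | r ∈ Ioo A B ∧ g r = 0} : Set ℝ) := ⟨ht, hgt⟩
      rw [hn] at this
      exact this)
    simpa using this
  | succ n ih =>
    intro A B hA hAB hfin hn
    by_cases hz : ∃ z, z ∈ Ioo A B ∧ g z = 0
    · obtain ⟨z, ⟨hz, hgz⟩, hmin⟩ := Set.exists_min_image _ id hfin hz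
      have h1 := h.Ham_le_of_g_ne_zero hH hr₀ hA hz.1.le (fun t ht hgt =>
        absurd (hmin t ⟨⟨ht.1, ht.2.trans hz.2⟩, hgt⟩) (not_le.2 ht.2))
      have hsub : {r | r ∈ Ioo z B ∧ g r = 0} ⊂ {r | r ∈ Ioo A B ∧ g r = 0} :=
        ⟨fun t ht => ⟨⟨hz.1.trans ht.1.1, ht.1.2⟩, ht.2⟩,
          fun hc => lt_irrefl z (hc (show z ∈ {r | r ∈ Ioo A B ∧ g r = 0} from ⟨hz, hgz⟩)).1.1⟩
      have h2 := ih z B (hA.trans hz.1.le) hz.2.le (hfin.subset hsub.1)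
        (by have := Set.ncard_lt_ncard hsub hfin; omega)
      push_cast
      linarith
    · have := h.Ham_le_of_g_ne_zero hH hr₀ hA hAB (fun t ht hgt => hz ⟨t, ht, hgt⟩)
      push_cast
      have : 0 ≤ ((n : ℝ) + 1) * (4 * √(a - b) / r₀) := by positivity
      linarith

/-- A solution tending to the origin with `k` zeros has little energy at any time. -/
theorem Ham_le_of_tendsto_of_ncard (h : DampedSol a b η φ x f g)
    (ht : Tendsto (fun r => (f r, g r)) atTop (𝓝 ((0 : ℝ), (0 : ℝ)))) {k : ℕ}
    (hfin : {r | 0 < r ∧ g r = 0}.Finite) (hk : {r | 0 < r ∧ g r = 0}.ncard ≤ k) {r₀ : ℝ}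
    (hr₀ : 0 < r₀) : Ham a b (f r₀) (g r₀) ≤ (k + 1) * (4 * √(a - b) / r₀) := by
  have h1 : Tendsto (fun r => Ham a b (f r) (g r)) atTop (𝓝 (Ham a b 0 0)) :=
    tendsto_Ham ht.fst_nhds ht.snd_nhds
  rw [show Ham a b 0 0 = 0 by unfold Ham; ring] at h1
  have h2 := h1.add_const ((k + 1) * (4 * √(a - b) / r₀))
  rw [zero_add] at h2
  refine ge_of_tendsto h2 ?_
  filter_upwards [eventually_ge_atTop r₀] with B hB
  have hsub : {r | r ∈ Ioo r₀ B ∧ g r = 0} ⊆ {r | 0 < r ∧ g r = 0} :=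
    fun t ht => ⟨hr₀.trans ht.1.1, ht.2⟩
  exact h.Ham_le_of_ncard_le (fun r hr => h.Ham_pos_of_tendsto ht hr) hr₀ k r₀ B le_rfl hB
    (hfin.subset hsub) ((Set.ncard_le_ncard hsub hfin).trans hk)

/-- Solutions starting near `g = 1` keep almost all their energy for a long time. -/
theorem le_Ham (h : DampedSol a b η φ x f g) {r : ℝ} (hr : 0 ≤ r) :
    a / 4 - b / 2 - a / 2 * ((1 - x ^ 2) * exp (2 * √(a - b) * r)) ≤ Ham a b (f r) (g r) := by
  have hcg := h.continuousOn_g_Icc (A := 0) (B := r) le_rfl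
  have h1 := le_mul_exp_of_hasDerivAt_le (u := fun t => 1 - g t ^ 2)
    (u' := fun t => -2 * (f t * g t) * (1 - g t ^ 2)) (C := 2 * √(a - b)) hr (by fun_prop)
    (fun t ht => (((h.hasDerivAt_g ht.1).pow 2).const_sub 1).congr_deriv (by push_cast; ring))
    (fun t ht => by
      have h2 := h.g_sq_lt_one ht.1.le
      have h3 : |f t * g t| ≤ √(a - b) := by
        rw [abs_mul]
        exact (mul_le_of_le_one_right (abs_nonneg _) (h.abs_g_lt_one ht.1.le).le).trans
          (h.abs_f_lt ht.1.le).le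
      exact mul_le_mul_of_nonneg_right (by linarith [(abs_le.1 h3).1]) (by linarith))
  simp only [h.sol.2.1, sub_zero] at h1
  have h2 := Ham_sub_max a b (f r) (g r)
  have h3 := h.g_sq_lt_one hr
  have ha := h.a_pos
  have h4 : (1 - g r ^ 2) * (a / 4 * (1 + g r ^ 2) - b / 2 - f r ^ 2 / 2) ≤
      (1 - g r ^ 2) * (a / 2) := by
    refine mul_le_mul_of_nonneg_left ?_ (by linarith)
    nlinarith [h.hb, sq_nonneg (f r)]
  have h5 := mul_le_mul_of_nonneg_left h1 (by positivity : 0 ≤ a / 2)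
  linarith

/-- While `g` decreases at low energy with `a g² ≤ 2b`, the quantity `r H` decreases by a definite
amount controlled by the variation of `g`. -/
theorem mul_Ham_sub_le (h : DampedSol a b η φ x f g) {R v : ℝ} (hR : 0 < R) (hRv : R ≤ v)
    (hE : Ham a b (f R) (g R) < 3 / 16 * (a - 2 * b)) (hv : 0 < Ham a b (f v) (g v))
    (hf : ∀ t ∈ Icc R v, f t ≤ 0) (hg : ∀ t ∈ Icc R v, a * g t ^ 2 ≤ 2 * b) :
    √(a - b) * (v * Ham a b (f v) (g v)) - (b / 2 * g v ^ 3 - 3 * a / 20 * g v ^ 5) ≤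
      √(a - b) * (R * Ham a b (f R) (g R)) - (b / 2 * g R ^ 3 - 3 * a / 20 * g R ^ 5) := by
  have hHc : ContinuousOn (fun r => Ham a b (f r) (g r)) (Icc R v) :=
    h.continuousOn_Ham.mono fun _ hs => hR.le.trans hs.1
  have hcg := h.continuousOn_g_Icc (A := R) (B := v) hR.le
  have hdH := fun t (ht : 0 < t) => h.hasDerivAt_Ham ht
  have hHt : ∀ t ∈ Ioo R v, 0 < Ham a b (f t) (g t) := fun t ht =>
    hv.trans_le (h.Ham_antitone (hR.trans ht.1).le ht.2.le)
  have hHE : ∀ t ∈ Ioo R v, Ham a b (f t) (g t) < 3 / 16 * (a - 2 * b) := fun t ht =>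
    (h.Ham_antitone hR.le ht.1.le).trans_lt hE
  have hHdef : ∀ t, Ham a b (f t) (g t) =
      1 / 2 * f t ^ 2 * (1 - g t ^ 2) - 1 / 2 * (g t ^ 2 * (b - a * g t ^ 2 / 2)) := fun t => by
    unfold Ham; ring
  have hφ : ∀ t ∈ Ioo R v, φ (f t) (g t) = 1 := fun t ht =>
    h.cutoff_eq_one (g t) (sq_lt_of_Ham_lt h.hb h.hab
      (h.g_sq_lt_one (hR.trans ht.1).le) (hHE t ht)).le
  generalize hE : (fun t => Ham a b (f t) (g t)) = E at hHc hdH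
  have hEt : ∀ t, Ham a b (f t) (g t) = E t := fun t => by rw [← hE]
  simp only [hEt] at hHt hHdef ⊢
  refine le_of_hasDerivAt_nonpos
    (u := fun t => √(a - b) * (t * E t) - (b / 2 * g t ^ 3 - 3 * a / 20 * g t ^ 5))
    (u' := fun t => √(a - b) * (1 * E t +
      t * (-(2 * φ (f t) (g t) / t * f t ^ 2 * (1 - g t ^ 2)))) -
      (b / 2 * (3 * g t ^ 2 * (f t * (1 - g t ^ 2))) -
        3 * a / 20 * (5 * g t ^ 4 * (f t * (1 - g t ^ 2))))) hRv
    (by fun_prop) (fun t ht => ?_) (fun t ht => ?_)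
  · have ht0 := hR.trans ht.1
    have hd := h.hasDerivAt_g ht0
    have h1 := (((hasDerivAt_id t).mul (hdH t ht0)).const_mul √(a - b)).sub
      (((hd.pow 3).const_mul (b / 2)).sub ((hd.pow 5).const_mul (3 * a / 20)))
    refine h1.congr_deriv ?_
    simp only [id]
    push_cast
    ring
  · have ht0 := hR.trans ht.1
    have h1 := h.g_sq_lt_one ht0.le
    have hft := hf t (Ioo_subset_Icc_self ht)
    have hgt := hg t (Ioo_subset_Icc_self ht)
    have hEpos := hHt t ht
    have hEdef := hHdef t
    rw [hφ t ht]
    have e1 : t * (-(2 * 1 / t * f t ^ 2 * (1 - g t ^ 2))) = -2 * f t ^ 2 * (1 - g t ^ 2) := by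
      field_simp
    have e4 : g t ^ 4 = (g t ^ 2) ^ 2 := by ring
    rw [e1, e4]
    have hq0 := sq_nonneg (g t)
    generalize g t ^ 2 = q at *
    have hw : 0 ≤ q * (b - a * q / 2) := mul_nonneg hq0 (by linarith)
    have h5 : q * (b - a * q / 2) ≤ √(a - b) * (-f t) := by
      have h6 : q * (b - a * q / 2) ≤ f t ^ 2 := by
        nlinarith [mul_nonneg (sq_nonneg (f t)) hq0]
      have h7 := (abs_lt.1 (h.abs_f_lt ht0.le)).1
      nlinarith
    have h8 : E t ≤ 1 / 2 * f t ^ 2 * (1 - q) := by linarith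
    have h9 : √(a - b) * (1 * E t + -2 * f t ^ 2 * (1 - q)) ≤
        √(a - b) * (-(3 / 2) * f t ^ 2 * (1 - q)) :=
      mul_le_mul_of_nonneg_left (by linarith) h.sqrt_pos.le
    have h10 : 0 ≤ (-f t * (1 - q)) * (√(a - b) * (-f t) - q * (b - a * q / 2)) :=
      mul_nonneg (mul_nonneg (by linarith) (by linarith)) (by linarith)
    linarith

/-- If `g` is small, `f` points towards the axis `g = 0` and the energy is small compared to `1/R`,
then the solution cannot leave the neighbourhood of the origin after crossing `g = 0`; hence, if it
tends to the origin, it does not cross. -/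
theorem g_pos_of_Ham_small (h : DampedSol a b η φ x f g)
    (ht : Tendsto (fun r => (f r, g r)) atTop (𝓝 ((0 : ℝ), (0 : ℝ)))) {R : ℝ} (hR : 0 < R)
    (hgR : 0 < g R) (hfR : f R < 0) (hgs : a * g R ^ 2 < 2 * b)
    (hE : Ham a b (f R) (g R) < 3 / 16 * (a - 2 * b))
    (hRE : √(a - b) * (R * Ham a b (f R) (g R)) < b / 5 * √(2 * b / a) ^ 3) :
    ∀ r, R ≤ r → 0 < g r := by
  have ha := h.a_pos
  have hb := h.hb
  have hH := fun r hr => h.Ham_pos_of_tendsto ht (r := r) hr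
  set γ := √(2 * b / a) with hγ
  have hγ0 : 0 < γ := Real.sqrt_pos.2 (by positivity)
  have hγ2 : a * γ ^ 2 = 2 * b := by
    rw [hγ, Real.sq_sqrt (by positivity)]; field_simp
  have hgγ : g R < γ := by
    by_contra! hc
    nlinarith [mul_self_le_mul_self hγ0.le hc]
  have hfneg : ∀ r, R ≤ r → f r < 0 := by
    intro r hr
    by_contra! hfr
    have hcf := h.continuousOn_f_Icc (A := R) (B := r) hR.le
    have hcomp : IsCompact (Icc R r ∩ f ⁻¹' Ici 0) :=
      isCompact_Icc.of_isClosed_subset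
        (hcf.preimage_isClosed_of_isClosed isClosed_Icc isClosed_Ici) inter_subset_left
    obtain ⟨u, ⟨hu, hfu⟩, hmin⟩ := hcomp.exists_isLeast ⟨r, ⟨hr, le_rfl⟩, hfr⟩
    have hbefore : ∀ t ∈ Ico R u, f t < 0 := fun t ht => by
      by_contra! hc
      exact absurd (hmin ⟨⟨ht.1, ht.2.le.trans hu.2⟩, hc⟩) (not_le.2 ht.2)
    have hRu : R < u := hu.1.lt_of_ne (by rintro rfl; exact absurd hfu (not_le.2 hfR))
    have hfu0 : f u = 0 := by
      refine le_antisymm ?_ hfu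
      refine le_of_tendsto ((h.continuousAt_f (hR.trans hRu)).tendsto.mono_left
        (nhdsWithin_le_nhds (s := Iio u))) ?_
      filter_upwards [Ico_mem_nhdsLT hRu] with t ht using (hbefore t ht).le
    have hle : ∀ t ∈ Icc R u, f t ≤ 0 := fun t ht => by
      rcases ht.2.eq_or_lt with rfl | hlt
      · exact hfu0.le
      · exact (hbefore t ⟨ht.1, hlt⟩).le
    have hanti := h.g_antitoneOn (convex_Icc R u) (fun t ht => hR.trans_le ht.1) hle
    have hgu : g u < -γ := by
      have h1 := lt_of_f_eq_zero (a := a) (b := b) (v := g u)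
        (by simpa only [hfu0] using hH u (hR.trans hRu).le)
      have h2 : g u ≤ g R := hanti (left_mem_Icc.2 hRu.le) (right_mem_Icc.2 hRu.le) hRu.le
      by_contra! hc
      have h3 : g u ^ 2 ≤ γ ^ 2 := sq_le_sq' hc (h2.trans hgγ.le)
      nlinarith
    obtain ⟨v, hv, hgv⟩ := intermediate_value_Icc' hRu.le
      (h.continuousOn_g_Icc (A := R) (B := u) hR.le) (show -γ ∈ Icc (g u) (g R) from
        ⟨hgu.le, by linarith⟩)
    have hsq : ∀ t ∈ Icc R v, a * g t ^ 2 ≤ 2 * b := fun t ht => by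
      have htu : t ∈ Icc R u := ⟨ht.1, ht.2.trans hv.2⟩
      have h1 : g t ≤ g R := hanti (left_mem_Icc.2 hRu.le) htu ht.1
      have h2 : -γ ≤ g t := hgv ▸ hanti htu hv ht.2
      have : g t ^ 2 ≤ γ ^ 2 := sq_le_sq' h2 (h1.trans hgγ.le)
      nlinarith
    have hfin := h.mul_Ham_sub_le hR hv.1 hE (hH v (hR.le.trans hv.1))
      (fun t ht => hle t ⟨ht.1, ht.2.trans hv.2⟩) hsq
    have h1 : 0 ≤ √(a - b) * (v * Ham a b (f v) (g v)) := by
      have := hH v (hR.le.trans hv.1)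
      have := h.sqrt_pos
      have := hR.le.trans hv.1
      positivity
    have h2 : -(b / 2 * (-γ) ^ 3 - 3 * a / 20 * (-γ) ^ 5) = b / 5 * γ ^ 3 := by
      have : γ ^ 5 * a = 2 * b * γ ^ 3 := by rw [← hγ2]; ring
      linear_combination (-3 / 20) * this
    rw [hgv] at h1 hfin
    have h3 : 0 ≤ b / 2 * g R ^ 3 - 3 * a / 20 * g R ^ 5 := by
      have : b / 2 * g R ^ 3 - 3 * a / 20 * g R ^ 5 =
        g R ^ 3 * (b / 2 - 3 / 20 * (a * g R ^ 2)) := by ring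
      rw [this]
      exact mul_nonneg (by positivity) (by linarith)
    linarith
  have hanti := h.g_antitoneOn (convex_Ici R) (fun t ht => hR.trans_le ht)
    (fun t ht => (hfneg t ht).le)
  intro r hr
  by_contra! hgr
  have hstrict : g (r + 1) < g r := by
    have := h.neg.g_strictMonoOn (convex_Ici R) (fun t ht => hR.trans_le ht)
      (fun t ht => neg_pos.2 (hfneg t ht)) (mem_Ici.2 hr) (mem_Ici.2 (by linarith : R ≤ r + 1))
      (lt_add_one r)
    linarith
  have h1 : (0 : ℝ) ≤ g (r + 1) := by
    refine le_of_tendsto ht.snd_nhds ?_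
    filter_upwards [eventually_ge_atTop (r + 1)] with t ht
    exact hanti (mem_Ici.2 (by linarith)) (mem_Ici.2 (by linarith)) ht
  linarith

theorem eventually_lt_f (h : DampedSol a b η φ x f g) {ρ : ℝ} (hρ : 0 < ρ) (hf : 0 < f ρ) :
    ∀ᶠ δ in 𝓝[>] (0 : ℝ), δ < ρ ∧ ∀ t ∈ Icc (ρ - δ) (ρ + δ), f ρ / 2 < f t := by
  have h1 : ∀ᶠ t in 𝓝 ρ, f ρ / 2 < f t :=
    (h.continuousAt_f hρ).eventually_const_lt (half_lt_self hf)
  obtain ⟨δ₀, hδ₀, hball⟩ := Metric.eventually_nhds_iff.1 h1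
  filter_upwards [Ioo_mem_nhdsGT (lt_min hρ hδ₀)] with δ hδ
  refine ⟨hδ.2.trans_le (min_le_left _ _), fun t ht => hball ?_⟩
  have := hδ.2.trans_le (min_le_right _ _)
  rw [Real.dist_eq, abs_lt]
  constructor <;> linarith [ht.1, ht.2]

/-- Near a simple zero of `g`, every nearby solution has exactly one zero. -/
theorem eventually_existsUnique_zero_of_pos (h : DampedSol a b η φ x f g) {ρ : ℝ} (hρ : 0 < ρ)
    (hg : g ρ = 0) (hf : 0 < f ρ) : ∀ᶠ δ in 𝓝[>] (0 : ℝ), ∃ ε > 0, ∀ y u v,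
      DampedSol a b η φ y u v →
      (∀ t ∈ Icc (ρ - δ) (ρ + δ), |u t - f t| < ε ∧ |v t - g t| < ε) →
      ∃! z, z ∈ Icc (ρ - δ) (ρ + δ) ∧ v z = 0 := by
  filter_upwards [h.eventually_lt_f hρ hf, self_mem_nhdsWithin] with δ ⟨hδρ, hδ⟩ hδ0
  have hδ0 : 0 < δ := hδ0
  have hpos : ∀ t ∈ Icc (ρ - δ) (ρ + δ), 0 < t := fun t ht => by linarith [ht.1]
  have hmono := h.g_strictMonoOn (convex_Icc _ _) hpos (fun t ht => by linarith [hδ t ht])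
  have hl : ρ - δ ∈ Icc (ρ - δ) (ρ + δ) := ⟨le_rfl, by linarith⟩
  have hr : ρ + δ ∈ Icc (ρ - δ) (ρ + δ) := ⟨by linarith, le_rfl⟩
  have hm : ρ ∈ Icc (ρ - δ) (ρ + δ) := ⟨by linarith, by linarith⟩
  have h1 := hmono hl hm (by linarith)
  have h2 := hmono hm hr (by linarith)
  rw [hg] at h1 h2
  refine ⟨min (f ρ / 2) (min (-g (ρ - δ)) (g (ρ + δ))),
    lt_min (half_pos hf) (lt_min (neg_pos.2 h1) h2), fun y u v h' hclose => ?_⟩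
  have hu : ∀ t ∈ Icc (ρ - δ) (ρ + δ), 0 < u t := fun t ht => by
    have h3 := (abs_lt.1 ((hclose t ht).1.trans_le (min_le_left _ _))).1
    linarith [hδ t ht]
  have hv := h'.g_strictMonoOn (convex_Icc _ _) hpos hu
  have h3 := (abs_lt.1 ((hclose _ hl).2.trans_le ((min_le_right _ _).trans (min_le_left _ _)))).2
  have h4 := (abs_lt.1 ((hclose _ hr).2.trans_le ((min_le_right _ _).trans (min_le_right _ _)))).1
  obtain ⟨z, hz, hvz⟩ := intermediate_value_Icc (hl.2)
    (h'.continuousOn_g_Icc (A := ρ - δ) (B := ρ + δ) (by linarith))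
    (show (0 : ℝ) ∈ Icc (v (ρ - δ)) (v (ρ + δ)) from ⟨by linarith, by linarith⟩)
  exact ⟨z, ⟨hz, hvz⟩, fun w hw => hv.injOn hw.1 hz (hw.2.trans hvz.symm)⟩

theorem eventually_existsUnique_zero (h : DampedSol a b η φ x f g)
    (hH : ∀ r, 0 ≤ r → 0 < Ham a b (f r) (g r)) {ρ : ℝ} (hρ : 0 < ρ)
    (hg : g ρ = 0) : ∀ᶠ δ in 𝓝[>] (0 : ℝ), ∃ ε > 0, ∀ y u v,
      DampedSol a b η φ y u v →
      (∀ t ∈ Icc (ρ - δ) (ρ + δ), |u t - f t| < ε ∧ |v t - g t| < ε) →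
      ∃! z, z ∈ Icc (ρ - δ) (ρ + δ) ∧ v z = 0 := by
  have hne : f ρ ≠ 0 := f_ne_zero_of_g_eq_zero (by simpa only [hg] using hH ρ hρ.le)
  rcases hne.lt_or_gt with hf | hf
  · filter_upwards [h.neg.eventually_existsUnique_zero_of_pos hρ (neg_eq_zero.2 hg)
      (neg_pos.2 hf)] with δ ⟨ε, hε, hδ⟩
    refine ⟨ε, hε, fun y u v h' hclose => ?_⟩
    have := hδ (-y) _ _ h'.neg (fun t ht => by
      rw [neg_sub_neg, neg_sub_neg, abs_sub_comm, abs_sub_comm (g t)]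
      exact hclose t ht)
    simpa only [neg_eq_zero] using this
  · exact h.eventually_existsUnique_zero_of_pos hρ hg hf

theorem changesSignAt_of_pos (h : DampedSol a b η φ x f g) {ρ : ℝ} (hρ : 0 < ρ)
    (hg : g ρ = 0) (hf : 0 < f ρ) : ChangesSignAt g (Ioi 0) ρ := by
  obtain ⟨δ, ⟨hδρ, hδ⟩, hδ0⟩ := ((h.eventually_lt_f hρ hf).and self_mem_nhdsWithin).exists
  have hδ0 : 0 < δ := hδ0
  have hpos : ∀ t ∈ Icc (ρ - δ) (ρ + δ), 0 < t := fun t ht => by linarith [ht.1]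
  have hmono := h.g_strictMonoOn (convex_Icc _ _) hpos (fun t ht => by linarith [hδ t ht])
  have key : ∀ r ∈ Ioc 0 δ, g (ρ - r) * g (ρ + r) < 0 := fun r hr => by
    have hm : ρ ∈ Icc (ρ - δ) (ρ + δ) := ⟨by linarith, by linarith⟩
    have h1 := hmono (a := ρ - r) ⟨by linarith [hr.2], by linarith [hr.1]⟩ hm (by linarith [hr.1])
    have h2 := hmono hm (b := ρ + r) ⟨by linarith [hr.1], by linarith [hr.2]⟩ (by linarith [hr.1])
    rw [hg] at h1 h2
    exact mul_neg_of_neg_of_pos h1 h2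
  exact ⟨hg, δ, hδ0, hpos, key δ ⟨hδ0, le_rfl⟩, fun r hr => (key r ⟨hr.1, hr.2.le⟩).le⟩

/-- When the energy is positive, the sign changes of `g` are exactly its zeros. -/
theorem setOf_changesSignAt (h : DampedSol a b η φ x f g)
    (hH : ∀ r, 0 ≤ r → 0 < Ham a b (f r) (g r)) :
    {r | ChangesSignAt g (Ioi 0) r} = {r | 0 < r ∧ g r = 0} := by
  ext ρ
  refine ⟨fun ⟨hg, ε, hε, hsub, _⟩ => ⟨hsub ⟨by linarith, by linarith⟩, hg⟩, fun ⟨hρ, hg⟩ => ?_⟩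
  have hne : f ρ ≠ 0 := f_ne_zero_of_g_eq_zero (by simpa only [hg] using hH ρ hρ.le)
  rcases hne.lt_or_gt with hf | hf
  · have := h.neg.changesSignAt_of_pos hρ (neg_eq_zero.2 hg) (neg_pos.2 hf)
    simpa only [mem_ofPred_eq, ChangesSignAt, neg_mul_neg, neg_eq_zero] using this
  · exact h.changesSignAt_of_pos hρ hg hf

/-- Along a solution tending to the origin with positive energy, `r H → 0`. -/
theorem tendsto_mul_Ham (h : DampedSol a b η φ x f g)
    (ht : Tendsto (fun r => (f r, g r)) atTop (𝓝 ((0 : ℝ), (0 : ℝ)))) :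
    Tendsto (fun r => r * Ham a b (f r) (g r)) atTop (𝓝 0) := by
  have ha := h.a_pos
  have hb := h.hb
  have h1 : ∀ᶠ r in atTop, f r ^ 2 ≤ a / 2 :=
    (ht.fst_nhds.pow 2).eventually_le_const (by simpa using ha)
  have h2 : ∀ᶠ r in atTop, a * g r ^ 2 ≤ 2 * b :=
    ((ht.snd_nhds.pow 2).const_mul a).eventually_le_const (by simpa using hb)
  obtain ⟨R, hR⟩ := eventually_atTop.1 ((h1.and h2).and (eventually_gt_atTop 0))
  have hR0 : 0 < R := (hR R le_rfl).2
  have hbound : ∀ r, R ≤ r → r ^ 2 * Ham a b (f r) (g r) ≤ R ^ 2 * Ham a b (f R) (g R) := by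
    intro r hr
    have hHc : ContinuousOn (fun r => Ham a b (f r) (g r)) (Icc R r) :=
      h.continuousOn_Ham.mono fun _ hs => hR0.le.trans hs.1
    refine le_of_hasDerivAt_nonpos (u := fun t => t ^ 2 * Ham a b (f t) (g t))
      (u' := fun t => 2 * t * Ham a b (f t) (g t) +
        t ^ 2 * (-(2 * φ (f t) (g t) / t * f t ^ 2 * (1 - g t ^ 2)))) hr
      ((by fun_prop : ContinuousOn (fun t : ℝ => t ^ 2) (Icc R r)).mul hHc)
      (fun t ht => ?_) (fun t ht => ?_)
    · have ht0 := hR0.trans ht.1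
      refine (((hasDerivAt_id t).pow 2).mul (h.hasDerivAt_Ham ht0)).congr_deriv ?_
      simp
    · have ht0 := hR0.trans ht.1
      obtain ⟨⟨h3, h4⟩, -⟩ := hR t ht.1.le
      have h5 := h.g_sq_lt_one ht0.le
      rw [h.cutoff_eq_one (g t) h3]
      have e : 2 * t * Ham a b (f t) (g t) + t ^ 2 * (-(2 * 1 / t * f t ^ 2 * (1 - g t ^ 2))) =
          -(t * (f t ^ 2 * (1 - g t ^ 2) + g t ^ 2 * (2 * b - a * g t ^ 2) / 2)) := by
        unfold Ham; field_simp; ring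
      rw [e, neg_nonpos]
      have h6 : 0 ≤ f t ^ 2 * (1 - g t ^ 2) := mul_nonneg (sq_nonneg _) (by linarith)
      have h7 : 0 ≤ g t ^ 2 * (2 * b - a * g t ^ 2) := mul_nonneg (sq_nonneg _) (by linarith)
      have : 0 ≤ f t ^ 2 * (1 - g t ^ 2) + g t ^ 2 * (2 * b - a * g t ^ 2) / 2 := by linarith
      positivity
  refine squeeze_zero' ?_ ?_ ((tendsto_inv_atTop_zero.const_mul
    (R ^ 2 * Ham a b (f R) (g R))).trans (by rw [mul_zero]))
  · filter_upwards [eventually_ge_atTop 0] with r hr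
    exact mul_nonneg hr (h.Ham_pos_of_tendsto ht hr).le
  · filter_upwards [eventually_ge_atTop R] with r hr
    have hr0 := hR0.trans_le hr
    rw [← div_eq_mul_inv, le_div_iff₀ hr0]
    linarith [hbound r hr]

/-- The open conditions that trap a solution tending to the origin away from `g = 0`. -/
theorem eventually_trapped_of_pos (h : DampedSol a b η φ x f g)
    (ht : Tendsto (fun r => (f r, g r)) atTop (𝓝 ((0 : ℝ), (0 : ℝ))))
    (hg : ∀ᶠ r in atTop, 0 < g r) : ∀ᶠ R in atTop,
      f R * g R < 0 ∧ a * g R ^ 2 < 2 * b ∧ Ham a b (f R) (g R) < 3 / 16 * (a - 2 * b) ∧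
      √(a - b) * (R * Ham a b (f R) (g R)) < b / 5 * √(2 * b / a) ^ 3 := by
  have ha := h.a_pos
  have hb := h.hb
  have hH := fun r hr => h.Ham_pos_of_tendsto ht (r := r) hr
  have h1 : Tendsto (fun r => Ham a b (f r) (g r)) atTop (𝓝 (Ham a b 0 0)) :=
    tendsto_Ham ht.fst_nhds ht.snd_nhds
  rw [show Ham a b 0 0 = 0 by unfold Ham; ring] at h1
  have h2 : ∀ᶠ r in atTop, a * g r ^ 2 < 2 * b :=
    ((ht.snd_nhds.pow 2).const_mul a).eventually_lt_const (by simpa using hb)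
  have h3 : ∀ᶠ r in atTop, Ham a b (f r) (g r) < 3 / 16 * (a - 2 * b) :=
    h1.eventually_lt_const (by linarith [h.hab])
  have h4 : ∀ᶠ r in atTop, √(a - b) * (r * Ham a b (f r) (g r)) < b / 5 * √(2 * b / a) ^ 3 :=
    ((h.tendsto_mul_Ham ht).const_mul _).eventually_lt_const (by rw [mul_zero]; positivity)
  obtain ⟨R, hR, hgR, hfR⟩ := h.eventually_f_sign hH hg
  have hf : ∀ r, R ≤ r → f r ≤ 0 := by
    refine hfR.resolve_left fun hf => ?_
    have hmono := h.g_monotoneOn (convex_Ici R) (fun t ht => hR.trans_le ht)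
      (fun t ht => (hf t ht).le)
    have : g R ≤ 0 := ge_of_tendsto ht.snd_nhds (by
      filter_upwards [eventually_ge_atTop R] with r hr using hmono (mem_Ici.2 le_rfl) hr hr)
    linarith [hgR R le_rfl]
  filter_upwards [h2, h3, h4, eventually_ge_atTop R] with r hr2 hr3 hr4 hr
  refine ⟨mul_neg_of_neg_of_pos ((hf r hr).lt_of_ne fun hf0 => ?_) (hgR r hr), hr2, hr3, hr4⟩
  have := lt_of_f_eq_zero (by simpa only [hf0] using hH r (hR.le.trans hr))
  linarith

theorem eventually_pos_or_neg (h : DampedSol a b η φ x f g)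
    (hfin : {r | 0 < r ∧ g r = 0}.Finite) :
    (∀ᶠ r in atTop, 0 < g r) ∨ (∀ᶠ r in atTop, g r < 0) := by
  obtain ⟨M, hM⟩ := hfin.bddAbove
  have hne : ∀ r, max M 0 < r → g r ≠ 0 := fun r hr h0 =>
    not_le.2 ((le_max_left _ _).trans_lt hr) (hM ⟨(le_max_right _ _).trans_lt hr, h0⟩)
  have hc : ContinuousOn g (Ioi (max M 0)) := fun r hr =>
    (h.continuousAt_g ((le_max_right _ _).trans_lt hr)).continuousWithinAt
  by_cases hpos : ∀ r ∈ Ioi (max M 0), 0 < g r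
  · exact Or.inl ((eventually_gt_atTop (max M 0)).mono hpos)
  · right
    push Not at hpos
    obtain ⟨p, hp, hgp⟩ := hpos
    filter_upwards [eventually_gt_atTop (max M 0)] with q hq
    by_contra! hgq
    obtain ⟨z, hz, hgz⟩ := isPreconnected_Ioi.intermediate_value hp hq hc ⟨hgp, hgq⟩
    exact hne z hz hgz

theorem tendsto_zero_of_finite (h : DampedSol a b η φ x f g)
    (hH : ∀ r, 0 ≤ r → 0 < Ham a b (f r) (g r)) (hfin : {r | 0 < r ∧ g r = 0}.Finite) :
    Tendsto (fun r => (f r, g r)) atTop (𝓝 ((0 : ℝ), (0 : ℝ))) := by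
  rcases h.eventually_pos_or_neg hfin with hg | hg
  · exact h.tendsto_zero_of_eventually_pos hH hg
  · have := (h.neg.tendsto_zero_of_eventually_pos (by simpa only [Ham_neg] using hH)
      (hg.mono fun r hr => neg_pos.2 hr)).neg
    simpa using this

theorem eventually_trapped (h : DampedSol a b η φ x f g)
    (ht : Tendsto (fun r => (f r, g r)) atTop (𝓝 ((0 : ℝ), (0 : ℝ))))
    (hfin : {r | 0 < r ∧ g r = 0}.Finite) : ∀ᶠ R in atTop,
      f R * g R < 0 ∧ a * g R ^ 2 < 2 * b ∧ Ham a b (f R) (g R) < 3 / 16 * (a - 2 * b) ∧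
      √(a - b) * (R * Ham a b (f R) (g R)) < b / 5 * √(2 * b / a) ^ 3 := by
  rcases h.eventually_pos_or_neg hfin with hg | hg
  · exact h.eventually_trapped_of_pos ht hg
  · have := h.neg.eventually_trapped_of_pos (by simpa using ht.neg)
      (hg.mono fun r hr => neg_pos.2 hr)
    simpa only [Ham_neg, neg_mul_neg, neg_sq] using this

theorem g_ne_zero_of_trapped (h : DampedSol a b η φ x f g)
    (ht : Tendsto (fun r => (f r, g r)) atTop (𝓝 ((0 : ℝ), (0 : ℝ)))) {R : ℝ} (hR : 0 < R)
    (hfg : f R * g R < 0) (hgs : a * g R ^ 2 < 2 * b)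
    (hE : Ham a b (f R) (g R) < 3 / 16 * (a - 2 * b))
    (hRE : √(a - b) * (R * Ham a b (f R) (g R)) < b / 5 * √(2 * b / a) ^ 3) :
    ∀ r, R ≤ r → g r ≠ 0 := by
  intro r hr
  rcases mul_neg_iff.1 hfg with ⟨hf, hg⟩ | ⟨hf, hg⟩
  · have := h.neg.g_pos_of_Ham_small (by simpa using ht.neg) hR (neg_pos.2 hg)
      (neg_neg_of_pos hf) (by simpa only [neg_sq] using hgs) (by simpa only [Ham_neg] using hE)
      (by simpa only [Ham_neg] using hRE) r hr
    linarith
  · exact (h.g_pos_of_Ham_small ht hR hg hf hgs hE hRE r hr).ne'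

end DampedSol

/-- An admissible cutoff function is globally `C¹`. -/
theorem IsCutoff.contDiff {a b η : ℝ} {φ : ℝ → ℝ → ℝ} (hφ : IsCutoff a b η φ) (hη : 0 < η) :
    ContDiff ℝ 1 fun p : ℝ × ℝ => φ p.1 p.2 := by
  rw [contDiff_iff_contDiffAt]
  intro p
  by_cases hp : |p.1| < √(a - b)
  · refine ContDiffAt.of_le (hφ.2.1.contDiffAt ?_) (by exact_mod_cast le_top)
    exact (isOpen_Ioo.prod isOpen_univ).mem_nhds ⟨abs_lt.1 hp, mem_univ _⟩
  · have h1 : ∀ᶠ q : ℝ × ℝ in 𝓝 p, √(a - b) - η / 2 < |q.1| :=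
      (continuous_fst.abs.tendsto p).eventually_const_lt (by linarith [not_lt.1 hp])
    refine (contDiffAt_const (c := (0 : ℝ))).congr_of_eventuallyEq ?_
    filter_upwards [h1] with q hq using hφ.2.2.2.1 _ _ hq.le

theorem exists_abs_sub_le_mul_max {Q : ℝ × ℝ → ℝ} (hQ : ContDiff ℝ 1 Q) (s M : ℝ) :
    ∃ L, 0 ≤ L ∧ ∀ u v u' v' : ℝ, |u| ≤ s → |v| ≤ M → |u'| ≤ s → |v'| ≤ M →
      |Q (u, v) - Q (u', v')| ≤ L * max |u - u'| |v - v'| := by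
  obtain ⟨L, hL⟩ := hQ.contDiffOn.exists_lipschitzOnWith one_ne_zero
    ((convex_Icc (-s) s).prod (convex_Icc (-M) M)) (isCompact_Icc.prod isCompact_Icc)
  refine ⟨L, L.2, fun u v u' v' hu hv hu' hv' => ?_⟩
  exact hL.dist_le_mul _ ⟨abs_le.1 hu, abs_le.1 hv⟩ _ ⟨abs_le.1 hu', abs_le.1 hv'⟩

namespace DampedSol

variable {a b η x : ℝ} {φ : ℝ → ℝ → ℝ} {f g : ℝ → ℝ}

theorem f_sq_le (h : DampedSol a b η φ x f g) {r : ℝ} (hr : 0 ≤ r) :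
    f r ^ 2 ≤ 2 * √(a - b) * a * r := by
  have hc := h.continuousOn_f_Icc (A := 0) (B := r) le_rfl
  have := le_of_hasDerivAt_nonpos (u := fun t => f t ^ 2 - 2 * √(a - b) * a * t)
    (u' := fun t => 2 * f t * (g t * (f t ^ 2 - a * g t ^ 2 + b) - 2 * φ (f t) (g t) / t * f t) -
      2 * √(a - b) * a) hr (by fun_prop)
    (fun t ht => (((h.hasDerivAt_f ht.1).pow 2).sub
      ((hasDerivAt_id t).const_mul (2 * √(a - b) * a))).congr_deriv (by push_cast; ring))
    (fun t ht => by
      have h1 : |f t * g t * (f t ^ 2 - a * g t ^ 2 + b)| ≤ √(a - b) * 1 * a := by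
        rw [abs_mul, abs_mul]
        have := h.a_pos
        gcongr
        exacts [(h.abs_f_lt ht.1.le).le, (h.abs_g_lt_one ht.1.le).le, h.abs_force_le ht.1.le]
      have h2 : 0 ≤ φ (f t) (g t) / t * f t ^ 2 :=
        mul_nonneg (div_nonneg (h.cutoff_nonneg _ _) ht.1.le) (sq_nonneg _)
      have h3 := (abs_le.1 h1).2
      have h4 : 2 * f t * (g t * (f t ^ 2 - a * g t ^ 2 + b) - 2 * φ (f t) (g t) / t * f t) =
        2 * (f t * g t * (f t ^ 2 - a * g t ^ 2 + b)) - 4 * (φ (f t) (g t) / t * f t ^ 2) := by ring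
      linarith)
  have h0 : f 0 = 0 := h.sol.1
  simp only [h0] at this
  linarith

/-- Lipschitz dependence on the initial datum, uniformly over all data. -/
theorem exists_sq_add_sq_le_mul_exp (h : DampedSol a b η φ x f g) :
    ∃ C, 0 ≤ C ∧ ∀ y u v, DampedSol a b η φ y u v → ∀ r, 0 ≤ r →
      (u r - f r) ^ 2 + (v r - g r) ^ 2 ≤ (y - x) ^ 2 * exp (C * r) := by
  have hs := h.sqrt_pos
  have ha := h.a_pos
  obtain ⟨L₁, hL₁0, hL₁⟩ := exists_abs_sub_le_mul_max
    (Q := fun p => p.2 * (p.1 ^ 2 - a * p.2 ^ 2 + b)) (by fun_prop) √(a - b) 1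
  obtain ⟨L₂, hL₂0, hL₂⟩ := exists_abs_sub_le_mul_max
    (Q := fun p => p.1 * (1 - p.2 ^ 2)) (by fun_prop) √(a - b) 1
  obtain ⟨L₃, hL₃0, hL₃⟩ := exists_abs_sub_le_mul_max
    (Q := fun p => φ p.1 p.2 * p.1) ((h.hφ.contDiff h.hη.1).mul contDiff_fst) √(a - b) 1
  have hc : 0 < √(a - b) - η := by linarith [h.hη.2, Real.sqrt_nonneg (a / 2)]
  obtain ⟨δ, hδ, hδe⟩ : ∃ δ > 0, 2 * √(a - b) * a * δ = (√(a - b) - η) ^ 2 :=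
    ⟨(√(a - b) - η) ^ 2 / (2 * √(a - b) * a), by positivity, by field_simp⟩
  have hone : ∀ y u v, DampedSol a b η φ y u v → ∀ r, 0 ≤ r → r ≤ δ → φ (u r) (v r) = 1 := by
    intro y u v hu r hr hrδ
    refine hu.hφ.2.2.2.2 _ _ (abs_le_of_sq_le_sq ?_ hc.le)
    rw [← hδe]
    exact (hu.f_sq_le hr).trans (by gcongr)
  refine ⟨2 * L₁ + 2 * L₂ + 4 / δ * L₃, by positivity, fun y u v hu r hr => ?_⟩
  have hcf := h.continuousOn_f_Icc (A := 0) (B := r) le_rfl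
  have hcg := h.continuousOn_g_Icc (A := 0) (B := r) le_rfl
  have hcu := hu.continuousOn_f_Icc (A := 0) (B := r) le_rfl
  have hcv := hu.continuousOn_g_Icc (A := 0) (B := r) le_rfl
  have key := le_mul_exp_of_hasDerivAt_le (u := fun t => (u t - f t) ^ 2 + (v t - g t) ^ 2)
    (u' := fun t => 2 * ((u t - f t) * (v t * (u t ^ 2 - a * v t ^ 2 + b) -
        g t * (f t ^ 2 - a * g t ^ 2 + b))) +
      2 * ((v t - g t) * (u t * (1 - v t ^ 2) - f t * (1 - g t ^ 2))) -
      4 / t * ((u t - f t) * (φ (u t) (v t) * u t - φ (f t) (g t) * f t)))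
    (C := 2 * L₁ + 2 * L₂ + 4 / δ * L₃) hr (by fun_prop)
    (fun t ht => by
      exact ((((hu.hasDerivAt_f ht.1).sub (h.hasDerivAt_f ht.1)).pow 2).add
        (((hu.hasDerivAt_g ht.1).sub (h.hasDerivAt_g ht.1)).pow 2)).congr_deriv
          (by simp only [Pi.sub_apply]; push_cast; ring))
    (fun t ht => by
      have ht0 : 0 < t := ht.1
      have bf := (h.abs_f_lt ht0.le).le
      have bg := (h.abs_g_lt_one ht0.le).le
      have bu := (hu.abs_f_lt ht0.le).le
      have bv := (hu.abs_g_lt_one ht0.le).le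
      have h1 := hL₁ _ _ _ _ bu bv bf bg
      have h2 := hL₂ _ _ _ _ bu bv bf bg
      have h3 := hL₃ _ _ _ _ bu bv bf bg
      simp only at h1 h2 h3 ⊢
      set m := max |u t - f t| |v t - g t| with hm
      have hm0 : 0 ≤ m := (abs_nonneg _).trans (le_max_left _ _)
      have hmu : |u t - f t| ≤ m := le_max_left _ _
      have hmv : |v t - g t| ≤ m := le_max_right _ _
      have hmD : m ^ 2 ≤ (u t - f t) ^ 2 + (v t - g t) ^ 2 := by
        rcases max_choice |u t - f t| |v t - g t| with h | h <;> rw [hm, h, sq_abs]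
        · exact le_add_of_nonneg_right (sq_nonneg _)
        · exact le_add_of_nonneg_left (sq_nonneg _)
      have e1 := (abs_le.1 ((abs_mul _ _).trans_le (mul_le_mul hmu h1 (abs_nonneg _) hm0))).2
      have e2 := (abs_le.1 ((abs_mul _ _).trans_le (mul_le_mul hmv h2 (abs_nonneg _) hm0))).2
      have e3 := (abs_le.1 ((abs_mul _ _).trans_le (mul_le_mul hmu h3 (abs_nonneg _) hm0))).1
      have e4 : -(4 / t * ((u t - f t) * (φ (u t) (v t) * u t - φ (f t) (g t) * f t))) ≤
          4 / δ * (L₃ * m ^ 2) := by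
        rcases le_total t δ with hle | hle
        · rw [hone _ _ _ h t ht0.le hle, hone _ _ _ hu t ht0.le hle, one_mul, one_mul]
          have : 0 ≤ 4 / t * ((u t - f t) * (u t - f t)) :=
            mul_nonneg (by positivity) (mul_self_nonneg _)
          have : 0 ≤ 4 / δ * (L₃ * m ^ 2) := by positivity
          linarith
        · rw [← mul_neg]
          have : 4 / t ≤ 4 / δ := by gcongr
          calc _ ≤ 4 / t * (L₃ * m ^ 2) := by gcongr; linarith
            _ ≤ _ := by gcongr
      calc _ ≤ 2 * (L₁ * m ^ 2) + 2 * (L₂ * m ^ 2) + 4 / δ * (L₃ * m ^ 2) := by linarith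
        _ = (2 * L₁ + 2 * L₂ + 4 / δ * L₃) * m ^ 2 := by ring
        _ ≤ _ := by gcongr)
  simpa only [h.sol.1, hu.sol.1, h.sol.2.1, hu.sol.2.1, sub_zero, sub_self, ne_eq,
    OfNat.ofNat_ne_zero, not_false_eq_true, zero_pow, zero_add] using key

/-- Solutions converge uniformly on compact intervals when the initial data converge. -/
theorem eventually_abs_sub_lt (h : DampedSol a b η φ x f g) {s : Set ℝ} {F G : ℝ → ℝ → ℝ}
    (hFG : ∀ y ∈ s, DampedSol a b η φ y (F y) (G y)) (R : ℝ) {ε : ℝ} (hε : 0 < ε) :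
    ∀ᶠ y in 𝓝[s] x, ∀ r ∈ Icc 0 R, |F y r - f r| < ε ∧ |G y r - g r| < ε := by
  obtain ⟨C, hC, hD⟩ := h.exists_sq_add_sq_le_mul_exp
  have h1 : Tendsto (fun y => (y - x) ^ 2 * exp (C * R)) (𝓝[s] x) (𝓝 0) := by
    have : Continuous fun y : ℝ => (y - x) ^ 2 * exp (C * R) := by fun_prop
    exact (this.tendsto' x 0 (by simp)).mono_left nhdsWithin_le_nhds
  filter_upwards [h1.eventually_lt_const (pow_pos hε 2), self_mem_nhdsWithin] with y hy hys r hr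
  have h2 := hD y _ _ (hFG y hys) r hr.1
  have h3 : (y - x) ^ 2 * exp (C * r) ≤ (y - x) ^ 2 * exp (C * R) := by
    gcongr
    exact hr.2
  constructor
  · exact abs_lt_of_sq_lt_sq (by nlinarith [sq_nonneg (G y r - g r)]) hε.le
  · exact abs_lt_of_sq_lt_sq (by nlinarith [sq_nonneg (F y r - f r)]) hε.le

theorem tendsto_pair (h : DampedSol a b η φ x f g) {s : Set ℝ} {F G : ℝ → ℝ → ℝ}
    (hFG : ∀ y ∈ s, DampedSol a b η φ y (F y) (G y)) {r : ℝ} (hr : 0 ≤ r) :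
    Tendsto (fun y => F y r) (𝓝[s] x) (𝓝 (f r)) ∧
      Tendsto (fun y => G y r) (𝓝[s] x) (𝓝 (g r)) := by
  simp only [Metric.tendsto_nhds, Real.dist_eq]
  exact ⟨fun ε hε => (h.eventually_abs_sub_lt hFG r hε).mono fun y hy => (hy r ⟨hr, le_rfl⟩).1,
    fun ε hε => (h.eventually_abs_sub_lt hFG r hε).mono fun y hy => (hy r ⟨hr, le_rfl⟩).2⟩

/-- Finitely many zeros of `g` persist, each in its own small interval, under perturbation of the
initial datum. -/
theorem exists_isolating (h : DampedSol a b η φ x f g)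
    (hH : ∀ r, 0 ≤ r → 0 < Ham a b (f r) (g r)) {s : Set ℝ} {F G : ℝ → ℝ → ℝ}
    (hFG : ∀ y ∈ s, DampedSol a b η φ y (F y) (G y)) (T : Finset ℝ)
    (hT : ∀ ρ ∈ T, 0 < ρ ∧ g ρ = 0) :
    ∃ δ > 0, (∀ ρ ∈ T, δ < ρ) ∧ ∀ᶠ y in 𝓝[s] x, ∃ z : ℝ → ℝ, InjOn z T ∧
      ∀ ρ ∈ T, z ρ ∈ Icc (ρ - δ) (ρ + δ) ∧ G y (z ρ) = 0 ∧
        ∀ w ∈ Icc (ρ - δ) (ρ + δ), G y w = 0 → w = z ρ := by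
  have hlt : ∀ c : ℝ, 0 < c → ∀ᶠ δ in 𝓝[>] (0 : ℝ), δ < c := fun c hc =>
    eventually_nhdsWithin_of_eventually_nhds (eventually_lt_nhds hc)
  have h1 : ∀ᶠ δ in 𝓝[>] (0 : ℝ), ∀ ρ ∈ T, δ < ρ :=
    (Filter.eventually_all_finset T).2 fun ρ hρ => hlt ρ (hT ρ hρ).1
  have h2 : ∀ᶠ δ in 𝓝[>] (0 : ℝ), ∀ ρ ∈ T, ∀ ρ' ∈ T, ρ ≠ ρ' → δ < |ρ - ρ'| / 2 := by
    refine (Filter.eventually_all_finset T).2 fun ρ _ => (Filter.eventually_all_finset T).2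
      fun ρ' _ => ?_
    by_cases hne : ρ = ρ'
    · exact Eventually.of_forall fun _ hn => absurd hne hn
    · exact (hlt _ (half_pos (abs_pos.2 (sub_ne_zero.2 hne)))).mono fun _ hδ _ => hδ
  have h3 := (Filter.eventually_all_finset T).2 fun ρ hρ =>
    h.eventually_existsUnique_zero hH (hT ρ hρ).1 (hT ρ hρ).2
  obtain ⟨δ, ⟨⟨hδ1, hδ2⟩, hδ3⟩, hδ0⟩ :=
    (((h1.and h2).and h3).and (self_mem_nhdsWithin : Ioi (0 : ℝ) ∈ 𝓝[>] 0)).exists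
  refine ⟨δ, hδ0, hδ1, ?_⟩
  have h4 : ∀ᶠ y in 𝓝[s] x, ∀ ρ ∈ T, ∃! z, z ∈ Icc (ρ - δ) (ρ + δ) ∧ G y z = 0 := by
    refine (Filter.eventually_all_finset T).2 fun ρ hρ => ?_
    obtain ⟨ε, hε, hz⟩ := hδ3 ρ hρ
    filter_upwards [h.eventually_abs_sub_lt hFG (ρ + δ) hε, self_mem_nhdsWithin] with y hy hys
    exact hz y _ _ (hFG y hys) fun t ht => hy t ⟨by linarith [ht.1, hδ1 ρ hρ], ht.2⟩
  filter_upwards [h4] with y hy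
  choose! z hz hzu using hy
  refine ⟨z, fun ρ hρ ρ' hρ' he => ?_, fun ρ hρ =>
    ⟨(hz ρ hρ).1, (hz ρ hρ).2, fun w hw hw0 => hzu ρ hρ w ⟨hw, hw0⟩⟩⟩
  by_contra hne
  have h5 := hδ2 ρ hρ ρ' hρ' hne
  have h6 := (hz ρ hρ).1
  have h7 := (hz ρ' hρ').1
  rw [he] at h6
  have h8 : |ρ - ρ'| ≤ 2 * δ := abs_le.2 ⟨by linarith [h6.2, h7.1], by linarith [h6.1, h7.2]⟩
  linarith

/-- Lower semicontinuity of the number of zeros. -/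
theorem finite_and_ncard_le (h : DampedSol a b η φ x f g)
    (hH : ∀ r, 0 ≤ r → 0 < Ham a b (f r) (g r)) {s : Set ℝ} {F G : ℝ → ℝ → ℝ}
    (hFG : ∀ y ∈ s, DampedSol a b η φ y (F y) (G y)) (hs : x ∈ closure s) {k : ℕ}
    (hfin : ∀ y ∈ s, {r | 0 < r ∧ G y r = 0}.Finite)
    (hk : ∀ y ∈ s, {r | 0 < r ∧ G y r = 0}.ncard ≤ k) :
    {r | 0 < r ∧ g r = 0}.Finite ∧ {r | 0 < r ∧ g r = 0}.ncard ≤ k := by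
  have := mem_closure_iff_nhdsWithin_neBot.1 hs
  have key : ∀ T : Finset ℝ, (T : Set ℝ) ⊆ {r | 0 < r ∧ g r = 0} → T.card ≤ k := by
    intro T hT
    obtain ⟨δ, hδ, hδT, hev⟩ := h.exists_isolating hH hFG T fun ρ hρ => hT hρ
    obtain ⟨y, ⟨z, hinj, hz⟩, hys⟩ := (hev.and self_mem_nhdsWithin).exists
    refine le_trans ?_ (hk y hys)
    rw [← Finset.card_image_of_injOn hinj, ← ncard_coe_finset]
    refine ncard_le_ncard ?_ (hfin y hys)
    intro w hw
    obtain ⟨ρ, hρ, rfl⟩ := Finset.mem_image.1 (Finset.mem_coe.1 hw)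
    exact ⟨by linarith [(hz ρ hρ).1.1, hδT ρ hρ], (hz ρ hρ).2.1⟩
  have hfin' : {r | 0 < r ∧ g r = 0}.Finite := by
    by_contra hinf
    obtain ⟨T, hT, hcard⟩ := Set.Infinite.exists_subset_card_eq hinf (k + 1)
    have := key T hT
    omega
  refine ⟨hfin', ?_⟩
  rw [ncard_eq_toFinset_card _ hfin']
  exact key _ (by simp)

/-- If the limiting solution has finitely many zeros, then nearby localised solutions have equally
many. -/
theorem eventually_ncard_eq (h : DampedSol a b η φ x f g)
    (hH : ∀ r, 0 ≤ r → 0 < Ham a b (f r) (g r)) {s : Set ℝ} {F G : ℝ → ℝ → ℝ}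
    (hFG : ∀ y ∈ s, DampedSol a b η φ y (F y) (G y))
    (ht : ∀ y ∈ s, Tendsto (fun r => (F y r, G y r)) atTop (𝓝 ((0 : ℝ), (0 : ℝ))))
    (hfin : {r | 0 < r ∧ g r = 0}.Finite) :
    ∀ᶠ y in 𝓝[s] x, {r | 0 < r ∧ G y r = 0}.ncard = {r | 0 < r ∧ g r = 0}.ncard := by
  have hmem : ∀ ρ, ρ ∈ hfin.toFinset ↔ 0 < ρ ∧ g ρ = 0 := fun ρ => by simp
  obtain ⟨δ, hδ, hδT, hev⟩ := h.exists_isolating hH hFG hfin.toFinset fun ρ => (hmem ρ).1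
  obtain ⟨R, ⟨hfg, hgs, hE, hRE⟩, hR⟩ :=
    ((h.eventually_trapped (h.tendsto_zero_of_finite hH hfin) hfin).and
      (eventually_gt_atTop 0)).exists
  have htR := h.tendsto_pair hFG hR.le
  have hHR := tendsto_Ham (a := a) (b := b) htR.1 htR.2
  have hK : IsCompact (Icc 0 R \ ⋃ ρ ∈ hfin.toFinset, Ioo (ρ - δ) (ρ + δ)) :=
    isCompact_Icc.diff (isOpen_biUnion fun _ _ => isOpen_Ioo)
  obtain ⟨c, hc, hgc⟩ := hK.exists_forall_le' (f := fun r => |g r|) (a := 0)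
    (h.continuousOn_g.mono fun r hr => hr.1.1).abs (fun r hr => by
      refine abs_pos.2 fun h0 => ?_
      rcases hr.1.1.eq_or_lt with rfl | hr0
      · exact h.hx0 (by rw [← h.sol.2.1, h0])
      · exact hr.2 (mem_biUnion (Finset.mem_coe.2 ((hmem r).2 ⟨hr0, h0⟩))
          ⟨by linarith, by linarith⟩))
  filter_upwards [hev, h.eventually_abs_sub_lt hFG R hc, self_mem_nhdsWithin,
    (htR.1.mul htR.2).eventually_lt_const hfg,
    ((htR.2.pow 2).const_mul a).eventually_lt_const hgs, hHR.eventually_lt_const hE,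
    ((hHR.const_mul R).const_mul √(a - b)).eventually_lt_const hRE]
    with y ⟨z, hinj, hz⟩ hclose hys h1 h2 h3 h4
  have htrap := (hFG y hys).g_ne_zero_of_trapped (ht y hys) hR h1 h2 h3 h4
  have hset : {r | 0 < r ∧ G y r = 0} = ((hfin.toFinset.image z : Finset ℝ) : Set ℝ) := by
    ext w
    simp only [Finset.coe_image, mem_image, Finset.mem_coe, mem_ofPred_eq]
    constructor
    · rintro ⟨hw0, hw⟩
      have hwR : w ≤ R := by
        by_contra! hRw
        exact htrap w hRw.le hw
      by_contra! hno
      have hwK : w ∈ Icc 0 R \ ⋃ ρ ∈ hfin.toFinset, Ioo (ρ - δ) (ρ + δ) := by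
        refine ⟨⟨hw0.le, hwR⟩, fun hmw => ?_⟩
        obtain ⟨ρ, hρ, hwρ⟩ := mem_iUnion₂.1 hmw
        exact hno ρ hρ ((hz ρ hρ).2.2 w (Ioo_subset_Icc_self hwρ) hw).symm
      have h5 := (hclose w ⟨hw0.le, hwR⟩).2
      rw [hw, zero_sub, abs_neg] at h5
      exact absurd (hgc w hwK) (not_le.2 h5)
    · rintro ⟨ρ, hρ, rfl⟩
      exact ⟨by linarith [(hz ρ hρ).1.1, hδT ρ hρ], (hz ρ hρ).2.1⟩
  rw [hset, ncard_coe_finset, Finset.card_image_of_injOn hinj, ncard_eq_toFinset_card _ hfin]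

/-- An upper bound below `1` for the initial data of localised solutions with at most `k` zeros. -/
theorem exists_lt_one_forall_le {a b : ℝ} (hb : 0 < b) (hab : 2 * b < a) (k : ℕ) :
    ∃ c < 1, ∀ η φ x f g, DampedSol a b η φ x f g →
      Tendsto (fun r => (f r, g r)) atTop (𝓝 ((0 : ℝ), (0 : ℝ))) →
      {r | 0 < r ∧ g r = 0}.Finite → {r | 0 < r ∧ g r = 0}.ncard ≤ k → x ≤ c := by
  have ha : 0 < a := by linarith
  have hs : 0 < √(a - b) := Real.sqrt_pos.2 (by linarith)
  obtain ⟨q, hq, hqe⟩ : ∃ q > 0, a / 4 - b / 2 = 2 * q :=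
    ⟨(a - 2 * b) / 8, by linarith, by ring⟩
  obtain ⟨r₀, hr₀, hre⟩ : ∃ r₀ > 0, (k + 1) * (4 * √(a - b) / r₀) = q :=
    ⟨(k + 1) * (4 * √(a - b)) / q, by positivity, by field_simp⟩
  have hE := exp_pos (2 * √(a - b) * r₀)
  obtain ⟨d, hd, hde⟩ : ∃ d > 0, a / 2 * (d * exp (2 * √(a - b) * r₀)) = q :=
    ⟨q / (a / 2 * exp (2 * √(a - b) * r₀)), by positivity, by field_simp⟩
  refine ⟨√(1 - d), (Real.sqrt_lt' one_pos).2 (by linarith), fun η φ x f g h ht hfin hk => ?_⟩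
  refine Real.le_sqrt_of_sq_le ?_
  have h1 := h.Ham_le_of_tendsto_of_ncard ht hfin hk hr₀
  have h2 := h.le_Ham hr₀.le
  rw [hqe] at h2
  rw [hre] at h1
  have h3 : a / 2 * (d * exp (2 * √(a - b) * r₀)) ≤
      a / 2 * ((1 - x ^ 2) * exp (2 * √(a - b) * r₀)) := by linarith
  have h4 := le_of_mul_le_mul_right (le_of_mul_le_mul_left h3 (by positivity)) hE
  linarith

end DampedSol

/-- Lemma 2.8 (v): if `I_k ≠ ∅` then `sup I_k ∈ I_k`. -/
theorem sup_Iset_mem (a b η : ℝ) (hb : 0 < b) (hab : 2 * b < a)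
    (hη : η ∈ Ioo 0 (Real.sqrt (a - b) - Real.sqrt (a / 2)))
    (φ : ℝ → ℝ → ℝ) (hφ : IsCutoff a b η φ)
    (F G : ℝ → ℝ → ℝ)
    (hFG : ∀ y ∈ Ioo (0 : ℝ) 1, IsRegSolOn a b φ y (F y) (G y) (Ici 0))
    (k : ℕ) (hne : (Iset a b F G k).Nonempty) :
    sSup (Iset a b F G k) ∈ Iset a b F G k := by
  have hsol : ∀ y ∈ Ioo (0 : ℝ) 1, DampedSol a b η φ y (F y) (G y) := fun y hy =>
    ⟨hb, hab, hη, hφ, hFG y hy, by nlinarith [hy.1, hy.2], hy.1.ne'⟩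
  have hI : ∀ y ∈ Iset a b F G k, DampedSol a b η φ y (F y) (G y) := fun y hy => hsol y hy.1
  have hIpos : ∀ y ∈ Iset a b F G k, ∀ r, 0 ≤ r → 0 < Ham a b (F y r) (G y r) :=
    fun y hy r hr => (hI y hy).Ham_pos_of_tendsto hy.2.1 hr
  have hIzero : ∀ y ∈ Iset a b F G k, {r | 0 < r ∧ G y r = 0}.Finite ∧
      {r | 0 < r ∧ G y r = 0}.ncard = k := fun y hy => by
    rw [← (hI y hy).setOf_changesSignAt (hIpos y hy)]
    exact hy.2.2
  obtain ⟨c, hc1, hc⟩ := DampedSol.exists_lt_one_forall_le hb hab k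
  have hle : ∀ y ∈ Iset a b F G k, y ≤ c := fun y hy =>
    hc η φ y _ _ (hI y hy) hy.2.1 (hIzero y hy).1 (hIzero y hy).2.le
  have hbdd : BddAbove (Iset a b F G k) := ⟨c, hle⟩
  have hcl : sSup (Iset a b F G k) ∈ closure (Iset a b F G k) := csSup_mem_closure hne hbdd
  have hIoo : sSup (Iset a b F G k) ∈ Ioo (0 : ℝ) 1 := by
    obtain ⟨y, hy⟩ := hne
    exact ⟨hy.1.1.trans_le (le_csSup hbdd hy), (csSup_le ⟨y, hy⟩ hle).trans_lt hc1⟩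
  have := mem_closure_iff_nhdsWithin_neBot.1 hcl
  have h := hsol _ hIoo
  have hH : ∀ r, 0 ≤ r → 0 < Ham a b (F (sSup (Iset a b F G k)) r) (G (sSup (Iset a b F G k)) r) :=
    fun r hr => h.Ham_pos_of_nonneg (fun r hr => by
      have ht := h.tendsto_pair hI hr
      refine ge_of_tendsto (tendsto_Ham ht.1 ht.2) ?_
      filter_upwards [self_mem_nhdsWithin] with y hy using (hIpos y hy r hr).le) hr
  have hfin := (h.finite_and_ncard_le hH hI hcl (fun y hy => (hIzero y hy).1)
    (fun y hy => (hIzero y hy).2.le)).1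
  refine ⟨hIoo, h.tendsto_zero_of_finite hH hfin, ?_⟩
  rw [ChangesSignExactly, h.setOf_changesSignAt hH]
  obtain ⟨y, hy, hyI⟩ := ((h.eventually_ncard_eq hH hI (fun y hy => hy.2.1) hfin).and
    self_mem_nhdsWithin).exists
  exact ⟨hfin, hy ▸ (hIzero y hyI).2⟩
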